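/- arXiv:1405.6390 — 9 statements merged into one kernel-verified Lean document; each statement's English description precedes it below -/
import Mathlib

section
/- For every ℚ-grading 𝔤 = ⊕_{j∈ℚ} 𝔤_j of a finite-dimensional complex simple Lie algebra 𝔤 (i.e. a direct sum decomposition into subspaces with [𝔤_i, 𝔤_j] ⊆ 𝔤_{i+j} for all i, j), there exists a semisimple element h_Γ ∈ 𝔤 such that 𝔤_j = {x ∈ 𝔤 : [h_Γ, x] = j x} for every j ∈ ℚ. -/
open Module LieAlgebra

/-- The endomorphism acting on each piece `g i` of an internal direct sum as the scalar `c i`. -/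
theorem DirectSum.IsInternal.exists_end_apply_eq_smul {ι R M : Type*} [DecidableEq ι]
    [CommRing R] [AddCommGroup M] [Module R M] {g : ι → Submodule R M}
    (hg : DirectSum.IsInternal g) (c : ι → R) :
    ∃ D : Module.End R M, ∀ i, ∀ x ∈ g i, D x = c i • x := by
  let e := LinearEquiv.ofBijective (DirectSum.coeLinearMap g) hg
  refine ⟨DirectSum.toModule R ι M (fun i ↦ c i • (g i).subtype) ∘ₗ e.symm.toLinearMap,
    fun i x hx ↦ ?_⟩
  have he : e.symm x = DirectSum.lof R ι (fun i ↦ g i) i ⟨x, hx⟩ := by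
    rw [LinearEquiv.symm_apply_eq]
    exact (DirectSum.coeLinearMap_lof g i ⟨x, hx⟩).symm
  simp [he]

/-- If `D` acts as the scalar `c i` on each piece of a grading, with `c` additive, then `D` is a
derivation. -/
theorem LieAlgebra.leibniz_of_grading {ι R L : Type*} [Add ι] [CommRing R] [LieRing L]
    [LieAlgebra R L] {g : ι → Submodule R L} (hg : ⨆ i, g i = ⊤)
    (hbr : ∀ i j, ∀ x ∈ g i, ∀ y ∈ g j, ⁅x, y⁆ ∈ g (i + j))
    {c : ι → R} (hc : ∀ i j, c (i + j) = c i + c j)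
    {D : Module.End R L} (hD : ∀ i, ∀ x ∈ g i, D x = c i • x) (x y : L) :
    D ⁅x, y⁆ = ⁅x, D y⁆ - ⁅y, D x⁆ := by
  have hx : x ∈ ⨆ i, g i := hg ▸ Submodule.mem_top
  have hy : y ∈ ⨆ i, g i := hg ▸ Submodule.mem_top
  induction hx using Submodule.iSup_induction' with
  | zero => simp
  | add x x' _ _ h h' => simp only [add_lie, map_add, lie_add, h, h']; abel
  | mem i x hx =>
    induction hy using Submodule.iSup_induction' with
    | zero => simp
    | add y y' _ _ h h' => simp only [add_lie, map_add, lie_add, h, h']; abel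
    | mem j y hy =>
      rw [hD _ _ (hbr i j x hx y hy), hD i x hx, hD j y hy, hc, lie_smul, lie_smul,
        ← lie_skew x y]
      module

/-- A spanning family lying below an independent family coincides with it. -/
theorem iSupIndep.eq_of_le_of_iSup_eq_top {ι α : Type*} [CompleteLattice α] [IsModularLattice α]
    {f E : ι → α} (hE : iSupIndep E) (hle : ∀ i, f i ≤ E i) (hf : ⨆ i, f i = ⊤) : f = E := by
  funext j
  refine eq_of_le_of_inf_le_of_sup_le (z := ⨆ i, ⨆ _ : i ≠ j, f i) (hle j) ?_ ?_
  · have hS : ⨆ i, ⨆ _ : i ≠ j, f i ≤ ⨆ i, ⨆ _ : i ≠ j, E i := iSup₂_mono fun i _ ↦ hle i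
    rw [((hE j).mono_right hS).eq_bot]
    exact bot_le
  · refine le_top.trans (hf ▸ iSup_le fun i ↦ ?_)
    obtain rfl | h := eq_or_ne i j
    · exact le_sup_left
    · exact le_sup_of_le_right (le_iSup₂_of_le i h le_rfl)

/-- **Lemma 2.1 (Sadaka).** Every `ℚ`-grading of a finite-dimensional complex simple Lie
algebra `𝔤` is defined by a semisimple element `h_Γ`: there is `h_Γ ∈ 𝔤` whose adjoint
action is diagonalizable (i.e. `𝔤` is the sum of its eigenspaces) and such that
`𝔤_j = {x ∈ 𝔤 : [h_Γ, x] = j x}` for every `j ∈ ℚ`. -/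
theorem stmt_0 (L : Type*) [LieRing L] [LieAlgebra ℂ L]
    [FiniteDimensional ℂ L] [LieAlgebra.IsSimple ℂ L]
    (g : ℚ → Submodule ℂ L)
    (hInt : DirectSum.IsInternal g)
    (hbr : ∀ i j : ℚ, ∀ x ∈ g i, ∀ y ∈ g j, ⁅x, y⁆ ∈ g (i + j)) :
    ∃ hΓ : L,
      (⨆ μ : ℂ, Module.End.eigenspace (ad ℂ L hΓ) μ) = ⊤ ∧
      ∀ j : ℚ, g j = Module.End.eigenspace (ad ℂ L hΓ) (j : ℂ) := by
  obtain ⟨D, hD⟩ := hInt.exists_end_apply_eq_smul (fun j : ℚ ↦ (j : ℂ))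
  have hsup := hInt.submodule_iSup_eq_top
  obtain ⟨h, hh⟩ := LieDerivation.IsKilling.exists_eq_ad
    (⟨D, leibniz_of_grading hsup hbr (by simp) hD⟩ : LieDerivation ℂ L L)
  have had (x : L) : ad ℂ L h x = D x := by
    rw [← LieDerivation.coe_ad_apply_eq_ad_apply, hh]
  have hle (j : ℚ) : g j ≤ End.eigenspace (ad ℂ L h) (j : ℂ) := fun x hx ↦
    End.mem_eigenspace_iff.mpr ((had x).trans (hD j x hx))
  refine ⟨h, top_unique ?_, congrFun (iSupIndep.eq_of_le_of_iSup_eq_top ?_ hle hsup)⟩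
  · exact hsup ▸ iSup_le fun j ↦ (hle j).trans (le_iSup (End.eigenspace (ad ℂ L h)) (j : ℂ))
  · exact (End.eigenspaces_iSupIndep (ad ℂ L h)).comp Rat.cast_injective
end

section
/- If Γ : 𝔤 = ⊕_{j∈ℤ} 𝔤_j is an e-admissible ℤ-grading with e ∈ 𝔤_a for an integer a > 1, then the map ad e sends ⊕_{j≥0} 𝔤_j onto ⊕_{j≥a} 𝔤_j. -/
open Module LieAlgebra

noncomputable section

variable {L : Type*} [LieRing L] [LieAlgebra ℂ L]

/-- The pair `(𝔪, 𝔫)` of subalgebras is `e`-admissible relative to the `ℤ`-grading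
`g : ℤ → Submodule ℂ L` with `e ∈ g a` (`a > 1`): `𝔪`, `𝔫` are Lie subalgebras, are
`Γ`-graded, and conditions (A2)–(A6) of Sadaka's Definition 2.2 hold. -/
def IsAdmissiblePair (g : ℤ → Submodule ℂ L) (e : L) (a : ℤ)
    (m n : Submodule ℂ L) : Prop :=
  -- `𝔪` and `𝔫` are Lie subalgebras of `𝔤`
  (∀ x ∈ m, ∀ y ∈ m, ⁅x, y⁆ ∈ m) ∧
  (∀ x ∈ n, ∀ y ∈ n, ⁅x, y⁆ ∈ n) ∧
  -- (A2): `𝔪`, `𝔫` are `Γ`-graded and `𝔤_{≤ -a} ⊆ 𝔪 ⊆ 𝔫 ⊆ 𝔤_{<0}`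
  m = (⨆ j : ℤ, g j ⊓ m) ∧
  n = (⨆ j : ℤ, g j ⊓ n) ∧
  (⨆ j ≤ -a, g j) ≤ m ∧ m ≤ n ∧ n ≤ (⨆ j < (0:ℤ), g j) ∧
  -- (A3): `𝔪^⊥ ∩ [𝔤, e] = [𝔫, e]`
  (LinearMap.BilinForm.orthogonal (killingForm ℂ L) m ⊓ LinearMap.range (ad ℂ L e)
      = Submodule.map (ad ℂ L e) n) ∧
  -- (A4): `𝔫 ∩ 𝔤^e = 0`
  n ⊓ LinearMap.ker (ad ℂ L e) = ⊥ ∧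
  -- (A5): `[𝔫, 𝔪] ⊆ 𝔪`
  (∀ x ∈ n, ∀ y ∈ m, ⁅x, y⁆ ∈ m) ∧
  -- (A6): `dim 𝔪 + dim 𝔫 = dim 𝔤 - dim 𝔤^e`
  finrank ℂ ↥m + finrank ℂ ↥n
    = finrank ℂ L - finrank ℂ ↥(LinearMap.ker (ad ℂ L e))

/-- Graded pieces of a `ℤ`-graded Lie algebra whose degrees do not add up to zero are orthogonal
for the Killing form. -/
lemma killingForm_eq_zero_of_add_ne_zero [FiniteDimensional ℂ L] {g : ℤ → Submodule ℂ L}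
    (hInt : DirectSum.IsInternal g)
    (hbr : ∀ i j : ℤ, ∀ x ∈ g i, ∀ y ∈ g j, ⁅x, y⁆ ∈ g (i + j))
    {i j : ℤ} (hij : i + j ≠ 0) {x y : L} (hx : x ∈ g i) (hy : y ∈ g j) :
    killingForm ℂ L x y = 0 := by
  rw [killingForm_apply_apply]
  refine LinearMap.trace_eq_zero_of_mapsTo_ne hInt (σ := fun k ↦ i + (j + k))
    (fun k ↦ by omega) fun k z hz ↦ ?_
  exact hbr i (j + k) x hx _ (hbr j k y hy z hz)

/-- As far as the Killing form against the piece of degree `j` is concerned, an element may be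
replaced by an element of degree `-j`. -/
lemma exists_mem_neg_killingForm_eq [FiniteDimensional ℂ L] {g : ℤ → Submodule ℂ L}
    (hInt : DirectSum.IsInternal g)
    (hbr : ∀ i j : ℤ, ∀ x ∈ g i, ∀ y ∈ g j, ⁅x, y⁆ ∈ g (i + j)) (j : ℤ) (y : L) :
    ∃ y' ∈ g (-j), ∀ z ∈ g j, killingForm ℂ L y z = killingForm ℂ L y' z := by
  have hy : y ∈ ⨆ k, g k := hInt.submodule_iSup_eq_top ▸ Submodule.mem_top
  induction hy using Submodule.iSup_induction' with
  | mem k y hy =>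
    rcases eq_or_ne k (-j) with rfl | hk
    · exact ⟨y, hy, fun _ _ ↦ rfl⟩
    · refine ⟨0, zero_mem _, fun z hz ↦ ?_⟩
      rw [killingForm_eq_zero_of_add_ne_zero hInt hbr (by omega) hy hz]
      simp
  | zero => exact ⟨0, zero_mem _, fun _ _ ↦ rfl⟩
  | add y₁ y₂ _ _ h₁ h₂ =>
    obtain ⟨y₁', hy₁', h₁⟩ := h₁
    obtain ⟨y₂', hy₂', h₂⟩ := h₂
    exact ⟨y₁' + y₂', add_mem hy₁' hy₂', fun z hz ↦ by simp [h₁ z hz, h₂ z hz]⟩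

/-- If `ad e`, with `e` of degree `a`, is injective on the piece of degree `-j`, then it maps the
piece of degree `j - a` onto the piece of degree `j`. -/
lemma le_map_ad_of_injOn [FiniteDimensional ℂ L] [LieAlgebra.IsKilling ℂ L]
    {g : ℤ → Submodule ℂ L} (hInt : DirectSum.IsInternal g)
    (hbr : ∀ i j : ℤ, ∀ x ∈ g i, ∀ y ∈ g j, ⁅x, y⁆ ∈ g (i + j))
    {a j : ℤ} {e : L} (hea : e ∈ g a) (hinj : ∀ y ∈ g (-j), ⁅e, y⁆ = 0 → y = 0) :
    g j ≤ Submodule.map (ad ℂ L e) (g (j - a)) := by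
  have hrefl : (killingForm ℂ L).IsRefl := (LieModule.traceForm_isSymm ℂ L L).isRefl
  rw [← LinearMap.BilinForm.orthogonal_orthogonal (IsKilling.killingForm_nondegenerate ℂ L) hrefl
    (Submodule.map (ad ℂ L e) (g (j - a)))]
  intro z hz y hy
  obtain ⟨y', hy', hyy'⟩ := exists_mem_neg_killingForm_eq hInt hbr j y
  suffices y' = 0 by
    change killingForm ℂ L y z = 0
    rw [hyy' z hz, this]
    simp
  refine hinj y' hy' ((IsKilling.killingForm_nondegenerate ℂ L).1 _ fun x ↦ ?_)
  obtain ⟨x', hx', hxx'⟩ := exists_mem_neg_killingForm_eq hInt hbr (a - j) x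
  have hmem : ⁅e, y'⁆ ∈ g (a - j) := hbr a (-j) e hea y' hy'
  rw [neg_sub] at hx'
  rw [LieModule.traceForm_comm, hxx' _ hmem, ← LieModule.traceForm_apply_lie_apply,
    LieModule.traceForm_comm, ← lie_skew, map_neg]
  have hex : ⁅e, x'⁆ ∈ g j := by simpa using hbr a (j - a) e hea x' hx'
  rw [← hyy' _ hex, LieModule.traceForm_comm, neg_eq_zero]
  exact hy _ ⟨x', hx', rfl⟩

/-- **Corollary 2.11 (Sadaka).** If the `ℤ`-grading `Γ` is `e`-admissible (with `e ∈ 𝔤_a`,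
`a > 1`), then `ad e` maps `⊕_{j≥0} 𝔤_j` onto `⊕_{j≥a} 𝔤_j`. -/
theorem stmt_2 {L : Type*} [LieRing L] [LieAlgebra ℂ L]
    [FiniteDimensional ℂ L] [LieAlgebra.IsSimple ℂ L]
    (e : L) (he : IsNilpotent (ad ℂ L e))
    (g : ℤ → Submodule ℂ L)
    (hInt : DirectSum.IsInternal g)
    (hbr : ∀ i j : ℤ, ∀ x ∈ g i, ∀ y ∈ g j, ⁅x, y⁆ ∈ g (i + j))
    (a : ℤ) (ha : 1 < a) (hea : e ∈ g a)
    (hadm : ∃ m n : Submodule ℂ L, IsAdmissiblePair g e a m n) :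
    Submodule.map (ad ℂ L e) (⨆ j ≥ (0:ℤ), g j) = (⨆ j ≥ a, g j) := by
  obtain ⟨m, n, -, -, -, -, hm, hmn, -, -, hker, -, -⟩ := hadm
  apply le_antisymm
  · simp only [Submodule.map_iSup, iSup_le_iff]
    rintro j hj _ ⟨x, hx, rfl⟩
    exact Submodule.mem_iSup_of_mem (a + j)
      (Submodule.mem_iSup_of_mem (by omega) (hbr a j e hea x hx))
  · refine iSup₂_le fun j hj ↦ (le_map_ad_of_injOn hInt hbr hea fun y hy hey ↦ ?_).trans
      (Submodule.map_mono (le_iSup₂_of_le (j - a) (by omega) le_rfl))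
    have hyn : y ∈ n := hmn (hm (Submodule.mem_iSup_of_mem (-j)
      (Submodule.mem_iSup_of_mem (by omega) hy)))
    exact (Submodule.mem_bot ℂ).1 (hker ▸ ⟨hyn, hey⟩)
end
end

section
/- Suppose e is distinguished, i.e. the centralizer 𝔤^e contains no nonzero semisimple element. Let Γ : 𝔤 = ⊕_{j∈ℤ} 𝔤_j be an e-admissible ℤ-grading with e ∈ 𝔤_a (a > 1), defined by the semisimple element h_Γ (so 𝔤_j is the j-eigenspace of ad h_Γ), and let (e,h,f) be an sl2-triple with h ∈ 𝔤_0 and f ∈ 𝔤_{−a}. Then h_Γ = (a/2)·h; consequently, up to rescaling of the grading, the Dynkin gradings associated to e are the only e-admissible gradings of 𝔤. -/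
open Module LieAlgebra

noncomputable section

variable {L : Type*} [LieRing L] [LieAlgebra ℂ L]

section SlTwo

variable {K V : Type*} [Field K] [CharZero K] [AddCommGroup V] [Module K V]
  {E F H : Module.End K V}

/-- The commutation rule `E Fᵐ⁺¹ = Fᵐ⁺¹ E + (m + 1) Fᵐ (H - m)` of an `sl₂`-triple. -/
lemma slTwo_apply_pow_succ (hEF : E * F = F * E + H) (hHF : H * F = F * H - (2 : K) • F)
    (m : ℕ) (v : V) :
    E ((F ^ (m + 1)) v)
      = (F ^ (m + 1)) (E v) + ((m : K) + 1) • (F ^ m) (H v - (m : K) • v) := by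
  have hEF' (v : V) : E (F v) = F (E v) + H v := by simpa using congrArg (· v) hEF
  have hHF' (v : V) : H (F v) = F (H v) - (2 : K) • F v := by simpa using congrArg (· v) hHF
  induction m generalizing v with
  | zero => simp [hEF']
  | succ m ih =>
    rw [pow_succ F (m + 1), Module.End.mul_apply, ih, hEF', hHF', Module.End.mul_apply]
    simp only [map_sub, map_add, map_smul, pow_succ, Module.End.mul_apply]
    push_cast
    module

lemma slTwo_eigenvector_eq_zero_or (hEF : E * F = F * E + H)
    (hHF : H * F = F * H - (2 : K) • F) {w : V} {μ : K} (hE : E w = 0) (hH : H w = μ • w)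
    (m : ℕ) (hF : (F ^ m) w = 0) : w = 0 ∨ ∃ n : ℕ, n < m ∧ μ = n := by
  induction m with
  | zero => exact .inl (by simpa using hF)
  | succ m ih =>
    have key := slTwo_apply_pow_succ hEF hHF m w
    rw [hF, hE, hH, ← sub_smul, map_smul, smul_smul] at key
    simp only [map_zero, zero_add] at key
    rcases smul_eq_zero.1 key.symm with h | h
    · rcases mul_eq_zero.1 h with h | h
      · exact absurd h (by exact_mod_cast m.succ_ne_zero)
      · exact .inr ⟨m, by simp, sub_eq_zero.1 h⟩
    · exact (ih h).imp_right fun ⟨n, hn, h⟩ ↦ ⟨n, by omega, h⟩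

/-- On `ker E`, where `F` acts locally nilpotently, `H` has no nontrivial Jordan blocks. -/
lemma slTwo_eq_smul_of_mem_ker (hEF : E * F = F * E + H)
    (hHE : H * E = E * H + (2 : K) • E) (hHF : H * F = F * H - (2 : K) • F)
    {μ : K} (m : ℕ) {p : V} (hE : E p = 0) (hF : (F ^ m) p = 0)
    (hH : H (H p - μ • p) = μ • (H p - μ • p)) : H p = μ • p := by
  have hHE' (v : V) : E (H v) = H (E v) - (2 : K) • E v := by
    have := congrArg (· v) hHE
    simp only [Module.End.mul_apply, LinearMap.add_apply, LinearMap.smul_apply] at this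
    rw [this]; abel
  induction m generalizing p with
  | zero =>
    have : p = 0 := by simpa using hF
    simp [this]
  | succ m ih =>
    have hEq : E (H p - (m : K) • p) = 0 := by simp [hHE', hE]
    have hFq : (F ^ m) (H p - (m : K) • p) = 0 := by
      have key := slTwo_apply_pow_succ hEF hHF m p
      rw [hF, hE] at key
      simp only [map_zero, zero_add] at key
      exact (smul_eq_zero.1 key.symm).resolve_left (by exact_mod_cast m.succ_ne_zero)
    have hq : H (H p - (m : K) • p) = μ • (H p - (m : K) • p) := by
      refine ih hEq hFq ?_
      have hH' : H (H p) = μ • H p + μ • (H p - μ • p) := by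
        rw [← hH]; simp
      simp only [map_sub, map_add, map_smul, hH']
      module
    by_cases hμ : μ = m
    · subst hμ
      rcases slTwo_eigenvector_eq_zero_or hEF hHF hEq hq m hFq with h | ⟨n, hn, h⟩
      · exact sub_eq_zero.1 h
      · exact absurd (Nat.cast_injective h) hn.ne'
    · have h0 : (μ - m) • (H p - μ • p) = 0 := by
        have h1 : H (H p) = (m : K) • H p + μ • (H p - (m : K) • p) := by
          rw [← hq]; simp
        have h2 : H (H p) = μ • H p + μ • (H p - μ • p) := by
          rw [← hH]; simp
        linear_combination (norm := module) h1 - h2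
      exact sub_eq_zero.1 ((smul_eq_zero.1 h0).resolve_left (sub_ne_zero.2 hμ))

/-- `E` maps the `(n - 2)`-eigenspace of `H` onto the `n`-eigenspace when `n > 0`. -/
lemma slTwo_exists_apply_eq (hEF : E * F = F * E + H)
    (hHE : H * E = E * H + (2 : K) • E) (hHF : H * F = F * H - (2 : K) • F)
    {n k : ℕ} (hn : 0 < n) {y : V} (hH : H y = (n : K) • y) (hE : (E ^ k) y = 0) :
    ∃ u, H u = ((n : K) - 2) • u ∧ E u = y := by
  have hHE' (v : V) : H (E v) = E (H v) + (2 : K) • E v := by simpa using congrArg (· v) hHE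
  have hHF' (v : V) : H (F v) = F (H v) - (2 : K) • F v := by simpa using congrArg (· v) hHF
  have hHEi (i : ℕ) : H ((E ^ i) y) = ((n : K) + 2 * i) • (E ^ i) y := by
    induction i with
    | zero => simp [hH]
    | succ i ih =>
      rw [pow_succ', Module.End.mul_apply, hHE', ih, map_smul]
      push_cast
      module
  have hHFi {z : V} {ν : K} (hz : H z = ν • z) (i : ℕ) :
      H ((F ^ i) z) = (ν - 2 * i) • (F ^ i) z := by
    induction i with
    | zero => simp [hz]
    | succ i ih =>
      rw [pow_succ', Module.End.mul_apply, hHF', ih, map_smul]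
      push_cast
      module
  suffices ∀ d i : ℕ, i + d = k → ∃ u, H u = ((n : K) - 2) • u ∧ E u = (F ^ i) ((E ^ i) y) by
    simpa using this k 0 (by simp)
  intro d
  induction d with
  | zero =>
    rintro i rfl
    exact ⟨0, by simp, by simp [show (E ^ i) y = 0 from hE]⟩
  | succ d ih =>
    intro i hi
    obtain ⟨u, hu, hEu⟩ := ih (i + 1) (by omega)
    set c : K := ((i : K) + 1) * ((n : K) + i) with hc
    have hc0 : c ≠ 0 := by
      have h1 : ((i : K) + 1) ≠ 0 := by exact_mod_cast i.succ_ne_zero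
      have h2 : ((n : K) + i) ≠ 0 := by exact_mod_cast (by omega : n + i ≠ 0)
      exact mul_ne_zero h1 h2
    refine ⟨c⁻¹ • ((F ^ (i + 1)) ((E ^ i) y) - u), ?_, ?_⟩
    · rw [map_smul, map_sub, hHFi (hHEi i), hu]
      push_cast
      module
    · rw [map_smul, map_sub, hEu, slTwo_apply_pow_succ hEF hHF, hHEi, ← sub_smul, map_smul,
        smul_smul, pow_succ' E, Module.End.mul_apply, add_sub_cancel_left, smul_smul,
        show ((i : K) + 1) * ((n : K) + 2 * i - i) = c by rw [hc]; ring, inv_mul_cancel₀ hc0,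
        one_smul]

/-- In a representation of `sl₂` on which `E` and `F` act locally nilpotently,
`H` has no nontrivial Jordan blocks. -/
lemma slTwo_eq_smul (hEF : E * F = F * E + H)
    (hHE : H * E = E * H + (2 : K) • E) (hHF : H * F = F * H - (2 : K) • F)
    (hFnil : ∀ v, ∃ m : ℕ, (F ^ m) v = 0) (k : ℕ) {μ : K} {v : V} (hE : (E ^ k) v = 0)
    (hH : H (H v - μ • v) = μ • (H v - μ • v)) : H v = μ • v := by
  have hHE' (v : V) : H (E v) = E (H v) + (2 : K) • E v := by simpa using congrArg (· v) hHE
  induction k generalizing μ v with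
  | zero =>
    have : v = 0 := by simpa using hE
    simp [this]
  | succ k ih =>
    have hHEv : H (E v) = (μ + 2) • E v := by
      refine ih (by simpa [pow_succ] using hE) ?_
      have h1 : H (E v) - (μ + 2) • E v = E (H v - μ • v) := by
        rw [hHE', map_sub, map_smul]; module
      rw [h1, hHE', hH, map_smul]; module
    have hEw : E (H v - μ • v) = 0 := by
      rw [map_sub, map_smul, ← sub_eq_zero.2 hHEv, hHE']; module
    obtain ⟨m, hm⟩ := hFnil (H v - μ • v)
    rcases slTwo_eigenvector_eq_zero_or hEF hHF hEw hH m hm with h | ⟨n, -, rfl⟩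
    · exact sub_eq_zero.1 h
    · obtain ⟨u, hu, hEu⟩ := slTwo_exists_apply_eq (n := n + 2) (k := k) hEF hHE hHF (by omega)
        (by simpa using hHEv) (by simpa [pow_succ] using hE)
      replace hu : H u = (n : K) • u := by simpa using hu
      have hsub : H (v - u) - (n : K) • (v - u) = H v - (n : K) • v := by
        rw [map_sub, hu]; module
      obtain ⟨l, hl⟩ := hFnil (v - u)
      have := slTwo_eq_smul_of_mem_ker (p := v - u) (μ := (n : K)) hEF hHE hHF l (by simp [hEu]) hl
        (by rw [hsub, hH])
      rwa [← sub_eq_zero, hsub, sub_eq_zero] at this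

lemma slTwo_iSup_eigenspace_eq_top [IsAlgClosed K] [FiniteDimensional K V]
    (hEF : E * F = F * E + H)
    (hHE : H * E = E * H + (2 : K) • E) (hHF : H * F = F * H - (2 : K) • F)
    (hEnil : ∀ v, ∃ m : ℕ, (E ^ m) v = 0) (hFnil : ∀ v, ∃ m : ℕ, (F ^ m) v = 0) :
    ⨆ μ, H.eigenspace μ = ⊤ := by
  rw [eq_top_iff, ← Module.End.iSup_maxGenEigenspace_eq_top H]
  refine iSup_mono fun μ v hv ↦ ?_
  obtain ⟨k, hk⟩ := (Module.End.mem_maxGenEigenspace H μ v).1 hv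
  clear hv
  induction k generalizing v with
  | zero =>
    have : v = 0 := by simpa using hk
    simp [this]
  | succ k ih =>
    have h1 := ih ((H - μ • 1) v) (by simpa [pow_succ] using hk)
    obtain ⟨m, hm⟩ := hEnil v
    rw [Module.End.mem_eigenspace_iff] at h1 ⊢
    exact slTwo_eq_smul hEF hHE hHF hFnil m hm (by simpa using h1)

end SlTwo

/-- An endomorphism shifting the eigenspaces of a diagonalizable endomorphism by a nonzero
constant is locally nilpotent. -/
lemma exists_pow_apply_eq_zero_of_shift {K V : Type*} [Field K] [CharZero K] [AddCommGroup V]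
    [Module K V] [FiniteDimensional K V] {D F : Module.End K V} {c : K} (hc : c ≠ 0)
    (hD : ⨆ μ, D.eigenspace μ = ⊤) (hDF : D * F = F * D + c • F) (v : V) :
    ∃ m : ℕ, (F ^ m) v = 0 := by
  have hDF' (v : V) : D (F v) = F (D v) + c • F v := by simpa using congrArg (· v) hDF
  have hv : v ∈ ⨆ μ, D.eigenspace μ := hD ▸ Submodule.mem_top
  induction hv using Submodule.iSup_induction' with
  | mem μ x hx =>
    rw [Module.End.mem_eigenspace_iff] at hx
    by_contra! hne
    have hi (i : ℕ) : D ((F ^ i) x) = (μ + i * c) • (F ^ i) x := by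
      induction i with
      | zero => simp [hx]
      | succ i ih =>
        rw [pow_succ', Module.End.mul_apply, hDF', ih, map_smul]
        push_cast
        module
    have hinj : Function.Injective fun i : ℕ ↦ μ + i * c := fun i j hij ↦ by
      simpa [hc] using hij
    refine Set.infinite_of_injective_forall_mem hinj (s := {ν | D.HasEigenvalue ν}) (fun i ↦ ?_)
      (Module.End.finite_hasEigenvalue D)
    exact Module.End.hasEigenvalue_of_hasEigenvector
      ⟨Module.End.mem_eigenspace_iff.2 (hi i), hne i⟩
  | zero => exact ⟨0, by simp⟩
  | add x y _ _ hx hy =>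
    obtain ⟨m, hm⟩ := hx
    obtain ⟨n, hn⟩ := hy
    refine ⟨m + n, ?_⟩
    have hx' : (F ^ (m + n)) x = 0 := by
      rw [add_comm, pow_add, Module.End.mul_apply, hm, map_zero]
    rw [map_add, hx', pow_add, Module.End.mul_apply, hn, map_zero, add_zero]

lemma iSup_eigenspace_sub_smul_eq_top {K V : Type*} [Field K] [AddCommGroup V]
    [Module K V] [FiniteDimensional K V] {D H : Module.End K V} (hcomm : Commute D H) (c : K)
    (hD : ⨆ μ, D.eigenspace μ = ⊤) (hH : ⨆ μ, H.eigenspace μ = ⊤) :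
    ⨆ μ, (D - c • H).eigenspace μ = ⊤ := by
  rw [eq_top_iff, ← hD]
  refine iSup_le fun μ ↦ ?_
  have hmap : ∀ x ∈ D.eigenspace μ, H x ∈ D.eigenspace μ :=
    Module.End.mapsTo_genEigenspace_of_comm hcomm μ 1
  have := Submodule.inf_iSup_genEigenspace (k := 1) hmap
  rw [show ⨆ ν, H.genEigenspace ν 1 = ⊤ from hH, inf_top_eq] at this
  rw [this]
  refine iSup_le fun ν ↦ le_trans (fun x hx ↦ ?_) (le_iSup _ (μ - c * ν))
  have h1 : D x = μ • x := Module.End.mem_eigenspace_iff.1 hx.1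
  have h2 : H x = ν • x := Module.End.mem_eigenspace_iff.1 hx.2
  rw [Module.End.mem_eigenspace_iff, LinearMap.sub_apply, LinearMap.smul_apply, h1, h2]
  module

/-- **Proposition 2.9 (Sadaka).** Suppose the nilpotent element `e` is distinguished, i.e.
`𝔤^e` contains no nonzero semisimple element (an element is semisimple when its adjoint
action is diagonalizable).  If `Γ : 𝔤 = ⊕_j 𝔤_j` is an `e`-admissible `ℤ`-grading defined by
the semisimple element `h_Γ` with `e ∈ 𝔤_a` (`a > 1`), and `(e, h, f)` is an `sl₂`-triple
with `h ∈ 𝔤_0`, `f ∈ 𝔤_{−a}`, then `h_Γ = (a/2) • h`; hence, up to rescaling, Dynkin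
gradings are the only `e`-admissible gradings. -/
theorem stmt_3 {L : Type*} [LieRing L] [LieAlgebra ℂ L]
    [FiniteDimensional ℂ L] [LieAlgebra.IsSimple ℂ L]
    (e : L) (he : IsNilpotent (ad ℂ L e))
    (hdist : ∀ x : L, ⁅e, x⁆ = 0 →
      (⨆ μ : ℂ, Module.End.eigenspace (ad ℂ L x) μ) = ⊤ → x = 0)
    (g : ℤ → Submodule ℂ L)
    (hInt : DirectSum.IsInternal g)
    (hΓ : L) (hdef : ∀ j : ℤ, g j = Module.End.eigenspace (ad ℂ L hΓ) (j : ℂ))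
    (a : ℤ) (ha : 1 < a) (hea : e ∈ g a)
    (hadm : ∃ m n : Submodule ℂ L, IsAdmissiblePair g e a m n)
    (h f : L) (hh : h ∈ g 0) (hf : f ∈ g (-a))
    (t1 : ⁅h, e⁆ = (2 : ℂ) • e) (t2 : ⁅e, f⁆ = h) (t3 : ⁅h, f⁆ = (-2 : ℂ) • f) :
    hΓ = ((a : ℂ) / 2) • h := by
  have hbr {j : ℤ} {x : L} (hx : x ∈ g j) : ⁅hΓ, x⁆ = (j : ℂ) • x := by
    rw [hdef, Module.End.mem_eigenspace_iff] at hx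
    simpa using hx
  have hΓe := hbr hea
  have hΓf := hbr hf
  have hΓh := hbr hh
  push_cast at hΓf hΓh
  rw [zero_smul] at hΓh
  have ha0 : (-(a : ℂ)) ≠ 0 := by
    rw [neg_ne_zero]
    exact_mod_cast (by omega : a ≠ 0)
  have hmul (x y : L) : ad ℂ L x * ad ℂ L y = ad ℂ L y * ad ℂ L x + ad ℂ L ⁅x, y⁆ := by
    ext z
    simp only [Module.End.mul_apply, LinearMap.add_apply, ad_apply]
    rw [leibniz_lie, add_comm]
  have hD : ⨆ μ : ℂ, (ad ℂ L hΓ).eigenspace μ = ⊤ := by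
    rw [eq_top_iff, ← hInt.submodule_iSup_eq_top]
    exact iSup_le fun j ↦ (hdef j).le.trans (le_iSup _ (j : ℂ))
  have hH : ⨆ μ : ℂ, (ad ℂ L h).eigenspace μ = ⊤ := by
    refine slTwo_iSup_eigenspace_eq_top (E := ad ℂ L e) (F := ad ℂ L f)
      (by rw [hmul, t2]) (by rw [hmul, t1, map_smul]) ?_ ?_ ?_
    · rw [hmul, t3, map_smul, neg_smul, sub_eq_add_neg]
    · obtain ⟨m, hm⟩ := he
      exact fun v ↦ ⟨m, by simp [hm]⟩
    · exact exists_pow_apply_eq_zero_of_shift ha0 hD (by rw [hmul, hΓf, map_smul])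
  refine sub_eq_zero.1 (hdist _ ?_ ?_)
  · rw [← lie_skew, sub_lie, smul_lie, hΓe, t1]
    module
  · rw [map_sub, map_smul]
    exact iSup_eigenspace_sub_smul_eq_top (by rw [commute_iff_eq, hmul, hΓh, map_zero, add_zero]) _ hD hH
end
end

section
/- Let Γ : 𝔤 = ⊕_{j∈ℤ} 𝔤_j be a ℤ-grading of 𝔤 with e ∈ 𝔤_a for an integer a > 1. Then Γ is e-admissible (i.e. there exists an e-admissible pair relative to Γ) if and only if (⊕_{j≤−a} 𝔤_j) ∩ 𝔤^e = 0. -/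
open Module LieAlgebra

noncomputable section

variable {L : Type*} [LieRing L] [LieAlgebra ℂ L]

/-- A submodule `p` has a complement `c` to `p ⊓ k` inside it. -/
lemma Submodule.exists_le_inf_eq_bot_sup_inf_eq {K V : Type*} [Field K] [AddCommGroup V]
    [Module K V] (p k : Submodule K V) :
    ∃ c ≤ p, c ⊓ k = ⊥ ∧ c ⊔ p ⊓ k = p := by
  obtain ⟨C, hC⟩ := (p ⊓ k).exists_isCompl
  refine ⟨C ⊓ p, inf_le_right, ?_, ?_⟩
  · rw [inf_assoc, inf_comm, hC.inf_eq_bot]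
  · rw [sup_comm, ← sup_inf_assoc_of_le C inf_le_left, hC.sup_eq_top, top_inf_eq]

/-- A bilinear map sends `(⨆ S, c) × (⨆ T, d)` into `P` if it does so on each summand. -/
lemma LinearMap.apply_apply_mem_of_mem_biSup {ι R M N Q : Type*} [CommSemiring R]
    [AddCommMonoid M] [AddCommMonoid N] [AddCommMonoid Q] [Module R M] [Module R N] [Module R Q]
    (f : M →ₗ[R] N →ₗ[R] Q) {S T : ι → Prop} {c : ι → Submodule R M} {d : ι → Submodule R N}
    {P : Submodule R Q}
    (h : ∀ i, S i → ∀ j, T j → ∀ x ∈ c i, ∀ y ∈ d j, f x y ∈ P)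
    {x : M} (hx : x ∈ ⨆ i, ⨆ (_ : S i), c i) {y : N} (hy : y ∈ ⨆ j, ⨆ (_ : T j), d j) :
    f x y ∈ P := by
  have hleft : (⨆ i, ⨆ (_ : S i), c i) ≤ P.comap (f.flip y) := iSup₂_le fun i hi x hx ↦
    (iSup₂_le fun j hj y hy ↦ h i hi j hj x hx y hy :
      (⨆ j, ⨆ (_ : T j), d j) ≤ P.comap (f x)) hy
  exact hleft hx

/-- A supremum of homogeneous submodules is graded. -/
lemma Submodule.biSup_eq_iSup_inf_of_le {ι R M : Type*} [Semiring R] [AddCommMonoid M]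
    [Module R M] {g c : ι → Submodule R M} (hc : ∀ i, c i ≤ g i) (S : ι → Prop) :
    (⨆ i, ⨆ (_ : S i), c i) = ⨆ j, g j ⊓ ⨆ i, ⨆ (_ : S i), c i := by
  refine le_antisymm (iSup₂_le fun i hi ↦ ?_) (iSup_le fun _ ↦ inf_le_right)
  exact le_trans (le_inf (hc i) (le_iSup₂_of_le i hi le_rfl))
    (le_iSup (fun j ↦ g j ⊓ ⨆ i, ⨆ (_ : S i), c i) i)

/-- A homogeneous linear map that is injective on homogeneous submodules `c i` is injective on
their supremum. -/
lemma iSupIndep.iSup_inf_ker_eq_bot {ι R M : Type*} [Ring R] [AddCommGroup M] [Module R M]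
    {g c : ι → Submodule R M} (hg : iSupIndep g) {σ : ι → ι} (hσ : Function.Injective σ)
    {f : M →ₗ[R] M} (hf : ∀ i, ∀ x ∈ g i, f x ∈ g (σ i)) (hc : ∀ i, c i ≤ g i)
    (hcf : ∀ i, c i ⊓ LinearMap.ker f = ⊥) :
    (⨆ i, c i) ⊓ LinearMap.ker f = ⊥ := by
  rw [eq_bot_iff]
  rintro x ⟨hx, hfx⟩
  obtain ⟨v, hv, rfl⟩ := (Submodule.mem_iSup_iff_exists_finsupp c x).mp hx
  have hzero := (iSupIndep_iff_finsetSum_eq_zero_imp_eq_zero (g ∘ σ)).mp (hg.comp hσ)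
    v.support (fun i ↦ f (v i)) (fun i _ ↦ hf i _ (hc i (hv i)))
    (by simpa [Finsupp.sum] using hfx)
  refine Submodule.sum_mem _ fun i hi ↦ ?_
  rw [← hcf i]
  exact ⟨hv i, hzero i hi⟩

/-- Pieces of a graded Lie algebra whose degrees do not add up to zero are orthogonal for the
Killing form. -/
lemma killingForm_apply_eq_zero_of_add_ne_zero {K L : Type*} [Field K] [LieRing L]
    [LieAlgebra K L] [FiniteDimensional K L] {g : ℤ → Submodule K L}
    (hInt : DirectSum.IsInternal g)
    (hbr : ∀ i j : ℤ, ∀ x ∈ g i, ∀ y ∈ g j, ⁅x, y⁆ ∈ g (i + j))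
    {i j : ℤ} (hij : i + j ≠ 0) {x y : L} (hx : x ∈ g i) (hy : y ∈ g j) :
    killingForm K L x y = 0 := by
  rw [killingForm_apply_apply]
  refine LinearMap.trace_eq_zero_of_mapsTo_ne hInt (fun k ↦ i + (j + k)) (fun k ↦ by lia) ?_
  exact fun k z hz ↦ hbr _ _ _ hx _ (hbr _ _ _ hy _ hz)

section KillingForm

variable {K L : Type*} [Field K] [LieRing L] [LieAlgebra K L]

/-- The Killing form pairs `[e, x]` with the centralizer of `e` trivially. -/
lemma killingForm_ker_ad_lie {e z : L} (hz : z ∈ LinearMap.ker (ad K L e)) (x : L) :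
    killingForm K L z ⁅e, x⁆ = 0 := by
  have hz' : ⁅z, e⁆ = 0 := by rw [← lie_skew, show ⁅e, z⁆ = 0 from hz, neg_zero]
  rw [← LieModule.traceForm_apply_lie_apply, hz', map_zero, LinearMap.zero_apply]

variable [FiniteDimensional K L] [IsKilling K L]

/-- The image of `ad e` is the Killing orthogonal of the centralizer of `e`. -/
lemma range_ad_eq_orthogonal_ker (e : L) :
    LinearMap.range (ad K L e) =
      LinearMap.BilinForm.orthogonal (killingForm K L) (LinearMap.ker (ad K L e)) := by
  refine Submodule.eq_of_le_of_finrank_eq ?_ ?_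
  · rintro _ ⟨x, rfl⟩ z hz
    exact killingForm_ker_ad_lie hz x
  · rw [LinearMap.BilinForm.finrank_orthogonal (IsKilling.killingForm_nondegenerate K L)]
    have := LinearMap.finrank_range_add_finrank_ker (ad K L e)
    lia

/-- Condition (A6) follows from (A3), (A4) and `𝔪 ⊆ 𝔫`. -/
lemma finrank_add_finrank_eq_of_orthogonal_inf_range_eq_map {e : L} {m n : Submodule K L}
    (hmn : m ≤ n) (hn : n ⊓ LinearMap.ker (ad K L e) = ⊥)
    (h : LinearMap.BilinForm.orthogonal (killingForm K L) m ⊓ LinearMap.range (ad K L e)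
      = Submodule.map (ad K L e) n) :
    finrank K m + finrank K n = finrank K L - finrank K (LinearMap.ker (ad K L e)) := by
  have hm : m ⊓ LinearMap.ker (ad K L e) = ⊥ := le_bot_iff.mp (hn ▸ inf_le_inf_right _ hmn)
  have hmap : finrank K (Submodule.map (ad K L e) n) = finrank K n := by
    rw [← LinearMap.range_domRestrict]
    refine LinearMap.finrank_range_of_inj (LinearMap.ker_eq_bot.mp ?_)
    rw [LinearMap.ker_domRestrict, ← Submodule.disjoint_iff_comap_eq_bot]
    exact disjoint_iff.mpr hn
  have hsup : LinearMap.BilinForm.orthogonal (killingForm K L) m ⊓ LinearMap.range (ad K L e)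
      = LinearMap.BilinForm.orthogonal (killingForm K L) (m ⊔ LinearMap.ker (ad K L e)) := by
    rw [range_ad_eq_orthogonal_ker]
    refine le_antisymm ?_ (le_inf (LinearMap.BilinForm.orthogonal_le le_sup_left)
      (LinearMap.BilinForm.orthogonal_le le_sup_right))
    rintro x ⟨h₁, h₂⟩ y hy
    obtain ⟨u, hu, v, hv, rfl⟩ := Submodule.mem_sup.mp hy
    have hux : killingForm K L u x = 0 := h₁ u hu
    have hvx : killingForm K L v x = 0 := h₂ v hv
    change killingForm K L (u + v) x = 0
    rw [map_add, LinearMap.add_apply, hux, hvx, add_zero]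
  have hdim := LinearMap.BilinForm.finrank_orthogonal (IsKilling.killingForm_nondegenerate K L)
    (m ⊔ LinearMap.ker (ad K L e))
  rw [← hsup, h, hmap] at hdim
  have hadd := Submodule.finrank_sup_add_finrank_inf_eq m (LinearMap.ker (ad K L e))
  rw [hm, finrank_bot] at hadd
  have hle := Submodule.finrank_le (m ⊔ LinearMap.ker (ad K L e))
  lia

end KillingForm

/-- Homogeneous complements of the centralizer of `e` in degrees `< -a/2` and `≤ -a/2` satisfy
(A3). -/
lemma orthogonal_inf_range_ad_eq_map {K L : Type*} [Field K] [LieRing L] [LieAlgebra K L]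
    [FiniteDimensional K L] [IsKilling K L] {g c : ℤ → Submodule K L}
    (hInt : DirectSum.IsInternal g)
    (hbr : ∀ i j : ℤ, ∀ x ∈ g i, ∀ y ∈ g j, ⁅x, y⁆ ∈ g (i + j))
    {a : ℤ} {e : L} (hea : e ∈ g a) (hcg : ∀ j, c j ≤ g j)
    (hsup : ∀ j, c j ⊔ g j ⊓ LinearMap.ker (ad K L e) = g j) :
    LinearMap.BilinForm.orthogonal (killingForm K L) (⨆ j, ⨆ (_ : 2 * j < -a), c j) ⊓
        LinearMap.range (ad K L e) =
      Submodule.map (ad K L e) (⨆ j, ⨆ (_ : 2 * j ≤ -a), c j) := by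
  let ω : L →ₗ[K] L →ₗ[K] K := (killingForm K L).compl₂ (ad K L e)
  have hω : ∀ {i j : ℤ}, i + j ≠ -a → ∀ {x y : L}, x ∈ g i → y ∈ g j →
      killingForm K L x ⁅e, y⁆ = 0 := fun hij _ _ hx hy ↦
    killingForm_apply_eq_zero_of_add_ne_zero hInt hbr (by lia) hx (hbr _ _ _ hea _ hy)
  have hmn : ∀ x ∈ ⨆ j, ⨆ (_ : 2 * j < -a), c j, ∀ y ∈ ⨆ j, ⨆ (_ : 2 * j ≤ -a), c j,
      killingForm K L x ⁅e, y⁆ = 0 := fun x hx y hy ↦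
    ω.apply_apply_mem_of_mem_biSup (P := ⊥)
      (fun i hi j hj x hx y hy ↦ hω (by lia) (hcg i hx) (hcg j hy)) hx hy
  have hle : ∀ S : ℤ → Prop, (⨆ j, ⨆ (_ : S j), g j) ≤
      (⨆ j, ⨆ (_ : S j), c j) ⊔ LinearMap.ker (ad K L e) := fun S ↦
    iSup₂_le fun j hj ↦ (hsup j).ge.trans
      (sup_le_sup (le_iSup₂_of_le j hj le_rfl) inf_le_right)
  have htop : ∀ S : ℤ → Prop,
      (⊤ : Submodule K L) ≤ (⨆ j, ⨆ (_ : S j), g j) ⊔ ⨆ j, ⨆ (_ : ¬ S j), g j := fun S ↦ by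
    rw [← hInt.submodule_iSup_eq_top]
    refine iSup_le fun j ↦ ?_
    by_cases hj : S j
    · exact le_sup_of_le_left (le_iSup₂_of_le j hj le_rfl)
    · exact le_sup_of_le_right (le_iSup₂_of_le j hj le_rfl)
  refine le_antisymm ?_ ?_
  · rintro _ ⟨horth, x, rfl⟩
    obtain ⟨x₁, hx₁, x₂, hx₂, rfl⟩ :=
      Submodule.mem_sup.mp (htop (fun j ↦ 2 * j ≤ -a) (Submodule.mem_top (x := x)))
    obtain ⟨y, hy, z, hz, rfl⟩ := Submodule.mem_sup.mp (hle _ hx₁)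
    have hz' : ⁅e, z⁆ = 0 := hz
    have hx₂m : ∀ u ∈ ⨆ j, ⨆ (_ : 2 * j < -a), c j, killingForm K L u ⁅e, x₂⁆ = 0 := by
      intro u hu
      have hu' : killingForm K L u ⁅e, y + z + x₂⁆ = 0 := horth u hu
      rwa [lie_add, lie_add, hz', add_zero, map_add, hmn u hu y hy, zero_add] at hu'
    have hx₂0 : ⁅e, x₂⁆ = 0 := by
      refine (IsKilling.killingForm_nondegenerate K L).2 _ fun w ↦ ?_
      obtain ⟨w₁, hw₁, w₂, hw₂, rfl⟩ :=
        Submodule.mem_sup.mp (htop (fun j ↦ 2 * j < -a) (Submodule.mem_top (x := w)))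
      obtain ⟨u, hu, v, hv, rfl⟩ := Submodule.mem_sup.mp (hle _ hw₁)
      have hw₂' : killingForm K L w₂ ⁅e, x₂⁆ = 0 :=
        ω.apply_apply_mem_of_mem_biSup (P := ⊥)
          (fun i hi j hj x hx y hy ↦ hω (by lia) hx hy) hw₂ hx₂
      rw [map_add, map_add, LinearMap.add_apply, LinearMap.add_apply, hx₂m u hu,
        killingForm_ker_ad_lie hv, hw₂', add_zero, add_zero]
    refine ⟨y, hy, ?_⟩
    rw [ad_apply, ad_apply, lie_add, lie_add, hz', hx₂0, add_zero, add_zero]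
  · rintro _ ⟨y, hy, rfl⟩
    exact ⟨fun x hx ↦ hmn x hx y hy, y, rfl⟩

/-- **Theorem 2.14 (Sadaka).** Let `Γ : 𝔤 = ⊕_{j∈ℤ} 𝔤_j` be a `ℤ`-grading with `e ∈ 𝔤_a`
for an integer `a > 1`.  Then `Γ` is `e`-admissible (i.e. there is an `e`-admissible pair
relative to `Γ`) if and only if `𝔤_{≤−a} ∩ 𝔤^e = 0`. -/
theorem stmt_5 {L : Type*} [LieRing L] [LieAlgebra ℂ L]
    [FiniteDimensional ℂ L] [LieAlgebra.IsSimple ℂ L]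
    (e : L) (he : IsNilpotent (ad ℂ L e))
    (g : ℤ → Submodule ℂ L)
    (hInt : DirectSum.IsInternal g)
    (hbr : ∀ i j : ℤ, ∀ x ∈ g i, ∀ y ∈ g j, ⁅x, y⁆ ∈ g (i + j))
    (a : ℤ) (ha : 1 < a) (hea : e ∈ g a) :
    (∃ m n : Submodule ℂ L, IsAdmissiblePair g e a m n) ↔
      (⨆ j ≤ -a, g j) ⊓ LinearMap.ker (ad ℂ L e) = ⊥ := by
  constructor
  · rintro ⟨m, n, -, -, -, -, ham, hmn, -, -, hn, -⟩
    exact le_bot_iff.mp (hn ▸ inf_le_inf_right _ (ham.trans hmn))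
  intro h
  choose c hcg hck hsup using fun j ↦
    (g j).exists_le_inf_eq_bot_sup_inf_eq (LinearMap.ker (ad ℂ L e))
  set m : Submodule ℂ L := ⨆ j, ⨆ (_ : 2 * j < -a), c j
  set n : Submodule ℂ L := ⨆ j, ⨆ (_ : 2 * j ≤ -a), c j
  have hmn : m ≤ n := biSup_mono fun _ hj ↦ hj.le
  have ham : (⨆ j ≤ -a, g j) ≤ m := iSup₂_le fun j hj ↦ by
    have hj' : g j ⊓ LinearMap.ker (ad ℂ L e) = ⊥ :=
      le_bot_iff.mp (h ▸ inf_le_inf_right _ (le_iSup₂_of_le j hj le_rfl))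
    have hcj := hsup j
    rw [hj', sup_bot_eq] at hcj
    exact hcj.ge.trans (le_iSup₂_of_le j (by lia) le_rfl)
  have hnn : ∀ x ∈ n, ∀ y ∈ n, ⁅x, y⁆ ∈ m := fun x hx y hy ↦
    ham ((ad ℂ L : L →ₗ[ℂ] End ℂ L).apply_apply_mem_of_mem_biSup
      (fun i hi j hj x hx y hy ↦ le_iSup₂_of_le (f := fun j (_ : j ≤ -a) ↦ g j) (i + j)
        (by lia) le_rfl (hbr i j x (hcg i hx) y (hcg j hy))) hx hy)
  have hnk : n ⊓ LinearMap.ker (ad ℂ L e) = ⊥ := by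
    have hck' := hInt.submodule_iSupIndep.iSup_inf_ker_eq_bot (add_right_injective a)
      (f := ad ℂ L e) (fun i x hx ↦ hbr a i e hea x hx) hcg hck
    exact le_bot_iff.mp (hck' ▸ inf_le_inf_right _ (iSup₂_le fun j _ ↦ le_iSup c j))
  have hA3 := orthogonal_inf_range_ad_eq_map hInt hbr hea hcg hsup
  refine ⟨m, n, fun x hx y hy ↦ hnn x (hmn hx) y (hmn hy),
    fun x hx y hy ↦ hmn (hnn x hx y hy), Submodule.biSup_eq_iSup_inf_of_le hcg _,
    Submodule.biSup_eq_iSup_inf_of_le hcg _, ham, hmn, ?_, hA3, hnk,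
    fun x hx y hy ↦ hnn x hx y (hmn hy),
    finrank_add_finrank_eq_of_orthogonal_inf_range_eq_map hmn hnk hA3⟩
  exact iSup₂_le fun j hj ↦ (hcg j).trans
    (le_iSup₂_of_le (f := fun j (_ : j < (0 : ℤ)) ↦ g j) j (by lia) le_rfl)
end
end

section
/- Let (𝔪,𝔫) be an e-admissible pair relative to a ℤ-grading Γ with e ∈ 𝔤_a (a > 1), and let 𝔰 be a Γ-graded subspace of 𝔪^⊥ complementary to [𝔫, e] in 𝔪^⊥. Then 𝔤 = [𝔤, e] ⊕ 𝔰. -/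
open Module LieAlgebra

noncomputable section

variable {L : Type*} [LieRing L] [LieAlgebra ℂ L]

/-- **Lemma 3.2 (Sadaka).** Let `(𝔪, 𝔫)` be an `e`-admissible pair relative to a
`ℤ`-grading `Γ` with `e ∈ 𝔤_a` (`a > 1`), and let `𝔰` be a `Γ`-graded subspace of `𝔪^⊥`
complementary to `[𝔫, e]` in `𝔪^⊥`.  Then `𝔤 = [𝔤, e] ⊕ 𝔰`. -/
theorem stmt_6 {L : Type*} [LieRing L] [LieAlgebra ℂ L]
    [FiniteDimensional ℂ L] [LieAlgebra.IsSimple ℂ L]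
    (e : L) (he : IsNilpotent (ad ℂ L e))
    (g : ℤ → Submodule ℂ L)
    (hInt : DirectSum.IsInternal g)
    (hbr : ∀ i j : ℤ, ∀ x ∈ g i, ∀ y ∈ g j, ⁅x, y⁆ ∈ g (i + j))
    (a : ℤ) (ha : 1 < a) (hea : e ∈ g a)
    (m n : Submodule ℂ L) (hp : IsAdmissiblePair g e a m n)
    (s : Submodule ℂ L)
    (hsg : s = (⨆ j : ℤ, g j ⊓ s))
    (hs0 : s ≤ LinearMap.BilinForm.orthogonal (killingForm ℂ L) m)
    (hs1 : s ⊓ Submodule.map (ad ℂ L e) n = ⊥)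
    (hs2 : s ⊔ Submodule.map (ad ℂ L e) n
      = LinearMap.BilinForm.orthogonal (killingForm ℂ L) m) :
    LinearMap.range (ad ℂ L e) ⊓ s = ⊥ ∧ LinearMap.range (ad ℂ L e) ⊔ s = ⊤ := by
  obtain ⟨-, -, -, -, -, -, -, hA3, hA4, -, hA6⟩ := hp
  have hdisj : LinearMap.range (ad ℂ L e) ⊓ s = ⊥ := by
    rw [eq_bot_iff, ← hs1]
    exact le_inf inf_le_right (hA3 ▸ le_inf (inf_le_right.trans hs0) inf_le_left)
  refine ⟨hdisj, Submodule.eq_top_of_finrank_eq (le_antisymm (Submodule.finrank_le _) ?_)⟩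
  have hmap : finrank ℂ (Submodule.map (ad ℂ L e) n) = finrank ℂ n := by
    have hinj : Function.Injective ((ad ℂ L e : L →ₗ[ℂ] L).domRestrict n) := by
      rw [← LinearMap.ker_eq_bot, eq_bot_iff]
      intro x hx
      have : (x : L) ∈ n ⊓ LinearMap.ker (ad ℂ L e) := ⟨x.2, by simpa using hx⟩
      rw [hA4] at this
      simpa using this
    rw [← LinearMap.range_domRestrict]
    exact LinearMap.finrank_range_of_inj hinj
  have horth := LinearMap.BilinForm.finrank_add_finrank_orthogonal
    (LieModule.traceForm_isSymm ℂ L L).isRefl (W := m)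
  have hrank := LinearMap.finrank_range_add_finrank_ker (ad ℂ L e)
  have hsup := Submodule.finrank_sup_add_finrank_inf_eq s (Submodule.map (ad ℂ L e) n)
  have hsup' := Submodule.finrank_sup_add_finrank_inf_eq (LinearMap.range (ad ℂ L e)) s
  rw [hs1, hs2, hmap, finrank_bot] at hsup
  rw [hdisj, finrank_bot] at hsup'
  change _ + finrank ℂ (LinearMap.BilinForm.orthogonal (killingForm ℂ L) m) = _ at horth
  omega
end
end

section
/- Let (𝔪,𝔫) be an e-admissible pair relative to a ℤ-grading Γ with e ∈ 𝔤_a (a > 1), and let 𝔰 be a Γ-graded subspace of 𝔪^⊥ complementary to [𝔫, e] in 𝔪^⊥. Then for every x ∈ e + 𝔰 one has [𝔤, x] + 𝔰 = 𝔤, and for every x ∈ e + 𝔪^⊥ one has [𝔤, x] + 𝔪^⊥ = 𝔤. (Equivalently, under the Killing isomorphism κ : 𝔤 → 𝔤*, the affine subvarieties χ + κ(𝔰) and χ + κ(𝔪^⊥) of 𝔤* are transverse to the coadjoint orbits at each of their points.) -/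
open Module LieAlgebra

noncomputable section

variable {L : Type*} [LieRing L] [LieAlgebra ℂ L]

section Grading

variable {V : Type*} [AddCommGroup V] [Module ℂ V] {g : ℤ → Submodule ℂ V}

/-- An internal grading has linear projections onto its homogeneous components. -/
lemma DirectSum.IsInternal.exists_proj (hInt : DirectSum.IsInternal g) :
    ∃ P : ℤ → V →ₗ[ℂ] V, (∀ k x, P k x ∈ g k) ∧ (∀ k, ∀ x ∈ g k, P k x = x) ∧
      (∀ j k, j ≠ k → ∀ x ∈ g j, P k x = 0) ∧ ∀ x, ∃ S : Finset ℤ, ∑ j ∈ S, P j x = x := by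
  classical
  let := hInt.chooseDecomposition
  refine ⟨fun k => (g k).subtype ∘ₗ DirectSum.component ℂ ℤ (fun i => g i) k ∘ₗ
    (DirectSum.decomposeLinearEquiv g).toLinearMap, fun k x => ?_, fun k x hx => ?_,
    fun j k hjk x hx => ?_, fun x => ?_⟩
  · exact Subtype.coe_prop _
  · exact DirectSum.decompose_of_mem_same g hx
  · exact DirectSum.decompose_of_mem_ne g hx hjk
  · exact ⟨_, DirectSum.sum_support_decompose g x⟩

/-- The homogeneous components of an element of a graded subspace lie in that subspace. -/
lemma proj_mem_of_graded {P : ℤ → V →ₗ[ℂ] V} (hP1 : ∀ k, ∀ x ∈ g k, P k x = x)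
    (hP0 : ∀ j k, j ≠ k → ∀ x ∈ g j, P k x = 0) {s : Submodule ℂ V}
    (hs : s = ⨆ j : ℤ, g j ⊓ s) {x : V} (hx : x ∈ s) (k : ℤ) : P k x ∈ s := by
  suffices (⨆ j : ℤ, g j ⊓ s) ≤ s.comap (P k) from this (hs ▸ hx)
  refine iSup_le fun j z hz => ?_
  rcases eq_or_ne j k with rfl | hjk
  · simpa [hP1 j z hz.1] using hz.2
  · simp [hP0 j k hjk z hz.1]

/-- A grading of a finite-dimensional space is bounded below. -/
lemma DirectSum.IsInternal.exists_forall_lt_eq_bot [FiniteDimensional ℂ V]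
    (hInt : DirectSum.IsInternal g) : ∃ N : ℤ, ∀ j < N, g j = ⊥ := by
  obtain ⟨N, hN⟩ := (WellFoundedGT.finite_ne_bot_of_iSupIndep
    hInt.submodule_iSupIndep).bddBelow
  refine ⟨N, fun j hj => ?_⟩
  by_contra h
  exact absurd (hN h) (not_le.mpr hj)

end Grading

section GradedLie

variable {L : Type*} [LieRing L] [LieAlgebra ℂ L] [FiniteDimensional ℂ L]
  {g : ℤ → Submodule ℂ L}

/-- Homogeneous components of non-opposite degrees are orthogonal for the Killing form. -/
lemma killingForm_eq_zero_of_graded (hInt : DirectSum.IsInternal g)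
    (hbr : ∀ i j : ℤ, ∀ x ∈ g i, ∀ y ∈ g j, ⁅x, y⁆ ∈ g (i + j))
    {i j : ℤ} (hij : i + j ≠ 0) {x y : L} (hx : x ∈ g i) (hy : y ∈ g j) :
    killingForm ℂ L x y = 0 := by
  rw [killingForm_apply_apply]
  refine LinearMap.trace_eq_zero_of_mapsTo_ne hInt (fun k => i + (j + k))
    (fun k h => hij (by linarith)) fun k z hz => ?_
  exact hbr _ _ x hx _ (hbr _ _ y hy z hz)

/-- If `𝔤_{≤ -a} ⊆ 𝔪` then `𝔪^⊥` is concentrated in degrees `< a`. -/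
lemma proj_eq_zero_of_mem_orthogonal [LieAlgebra.IsKilling ℂ L] (hInt : DirectSum.IsInternal g)
    (hbr : ∀ i j : ℤ, ∀ x ∈ g i, ∀ y ∈ g j, ⁅x, y⁆ ∈ g (i + j))
    {P : ℤ → L →ₗ[ℂ] L} (hPmem : ∀ k x, P k x ∈ g k)
    (hP0 : ∀ j k, j ≠ k → ∀ x ∈ g j, P k x = 0)
    (hPsum : ∀ x, ∃ S : Finset ℤ, ∑ j ∈ S, P j x = x)
    {m : Submodule ℂ L} {a : ℤ} (hm : (⨆ j ≤ -a, g j) ≤ m) {y : L}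
    (hy : y ∈ LinearMap.BilinForm.orthogonal (killingForm ℂ L) m) {j : ℤ} (hj : a ≤ j) :
    P j y = 0 := by
  refine (LieAlgebra.IsKilling.killingForm_nondegenerate ℂ L).2 _ fun w => ?_
  obtain ⟨S, hS⟩ := hPsum w
  rw [← hS, map_sum, LinearMap.sum_apply]
  refine Finset.sum_eq_zero fun i _ => ?_
  by_cases hij : i + j = 0
  · have hi : P i w ∈ m := hm (Submodule.mem_iSup_of_mem i
      (Submodule.mem_iSup_of_mem (by omega) (hPmem i w)))
    have h0 : killingForm ℂ L (P i w) y = 0 := hy _ hi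
    obtain ⟨T, hT⟩ := hPsum y
    by_cases hjT : j ∈ T
    · rw [← hT, map_sum, Finset.sum_eq_single_of_mem j hjT] at h0
      · exact h0
      · exact fun k _ hk =>
          killingForm_eq_zero_of_graded hInt hbr (by omega) (hPmem i w) (hPmem k y)
    · rw [← hT, map_sum, Finset.sum_eq_zero, map_zero]
      exact fun k hk => hP0 k j (fun h => hjT (h ▸ hk)) _ (hPmem k y)
  · exact killingForm_eq_zero_of_graded hInt hbr hij (hPmem i w) (hPmem j y)

/-- If `𝔤 = [𝔤, e] + 𝔰` with `𝔰` graded, then adding to `e` terms of lower degree preserves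
the equality. -/
lemma range_ad_add_sup_eq_top (hInt : DirectSum.IsInternal g)
    (hbr : ∀ i j : ℤ, ∀ x ∈ g i, ∀ y ∈ g j, ⁅x, y⁆ ∈ g (i + j))
    {P : ℤ → L →ₗ[ℂ] L} (hPmem : ∀ k x, P k x ∈ g k) (hP1 : ∀ k, ∀ x ∈ g k, P k x = x)
    (hP0 : ∀ j k, j ≠ k → ∀ x ∈ g j, P k x = 0)
    (hPsum : ∀ x, ∃ S : Finset ℤ, ∑ j ∈ S, P j x = x)
    {e : L} {a : ℤ} (hea : e ∈ g a) {s : Submodule ℂ L} (hsg : s = ⨆ j : ℤ, g j ⊓ s)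
    (hes : LinearMap.range (ad ℂ L e) ⊔ s = ⊤) {y : L} (hy : ∀ j, a ≤ j → P j y = 0) :
    LinearMap.range (ad ℂ L (e + y)) ⊔ s = ⊤ := by
  set R := LinearMap.range (ad ℂ L (e + y)) ⊔ s with hR
  have hproj : ∀ k u, P k ⁅e, u⁆ = ⁅e, P (k - a) u⁆ := by
    intro k u
    obtain ⟨S, hS⟩ := hPsum u
    rw [← hS, lie_sum, map_sum, map_sum, lie_sum]
    refine Finset.sum_congr rfl fun j _ => ?_
    have hj := hbr _ _ e hea _ (hPmem j u)
    rcases eq_or_ne j (k - a) with rfl | hjk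
    · rw [hP1 (k - a) _ (hPmem _ _), hP1 k]
      simpa using hj
    · rw [hP0 j (k - a) hjk _ (hPmem _ _), hP0 (a + j) k (by omega) _ hj, lie_zero]
  have step : ∀ k, (∀ j < k, g j ≤ R) → g k ≤ R := by
    intro k ih z hz
    obtain ⟨v, ⟨u, rfl⟩, t, ht, hvt⟩ := Submodule.mem_sup.mp (hes ▸ Submodule.mem_top (x := z))
    have hz' : z = ⁅e, P (k - a) u⁆ + P k t := by
      rw [← hproj, ← map_add, ← hP1 k z hz, ← hvt]
      simp
    have hlow : ⁅y, P (k - a) u⁆ ∈ R := by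
      obtain ⟨S, hS⟩ := hPsum y
      rw [← hS, sum_lie]
      refine Submodule.sum_mem _ fun j _ => ?_
      rcases le_or_gt a j with h | h
      · simp [hy j h]
      · exact ih (j + (k - a)) (by omega) (hbr _ _ _ (hPmem j y) _ (hPmem _ u))
    have hx : ⁅e + y, P (k - a) u⁆ ∈ R := Submodule.mem_sup_left ⟨P (k - a) u, rfl⟩
    have ht' : P k t ∈ R := Submodule.mem_sup_right (proj_mem_of_graded hP1 hP0 hsg ht k)
    have : z = ⁅e + y, P (k - a) u⁆ - ⁅y, P (k - a) u⁆ + P k t := by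
      rw [hz', add_lie]; abel
    exact this ▸ R.add_mem (R.sub_mem hx hlow) ht'
  obtain ⟨N, hN⟩ := hInt.exists_forall_lt_eq_bot
  have hall : ∀ k, N ≤ k → ∀ j < k, g j ≤ R := by
    intro k hk
    induction k, hk using Int.leInduction with
    | base => exact fun j hj => by simp [hN j hj]
    | succ k _ ih =>
      intro j hj
      rcases (Int.lt_add_one_iff.mp hj).lt_or_eq with h | rfl
      · exact ih j h
      · exact step j ih
  rw [eq_top_iff, ← hInt.submodule_iSup_eq_top]
  exact iSup_le fun j => hall (max N (j + 1)) (le_max_left _ _) j (by omega)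

/-- The transversality `[𝔤, e] + 𝔰 = 𝔤` at the base point, by counting dimensions. -/
lemma range_ad_sup_eq_top_of_admissible [LieAlgebra.IsKilling ℂ L] {e : L} {a : ℤ}
    {m n s : Submodule ℂ L} (hp : IsAdmissiblePair g e a m n)
    (hs0 : s ≤ LinearMap.BilinForm.orthogonal (killingForm ℂ L) m)
    (hs1 : s ⊓ Submodule.map (ad ℂ L e) n = ⊥)
    (hs2 : s ⊔ Submodule.map (ad ℂ L e) n
      = LinearMap.BilinForm.orthogonal (killingForm ℂ L) m) :
    LinearMap.range (ad ℂ L e) ⊔ s = ⊤ := by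
  obtain ⟨-, -, -, -, -, -, -, hA3, hA4, -, hA6⟩ := hp
  have hinf : LinearMap.range (ad ℂ L e) ⊓ s = ⊥ := by
    rw [eq_bot_iff, ← hs1, ← hA3]
    exact fun x hx => ⟨hx.2, hs0 hx.2, hx.1⟩
  have h1 := Submodule.finrank_sup_add_finrank_inf_eq (LinearMap.range (ad ℂ L e)) s
  have h2 := Submodule.finrank_sup_add_finrank_inf_eq s (Submodule.map (ad ℂ L e) n)
  have h3 := LinearMap.finrank_range_add_finrank_ker (ad ℂ L e)
  have h4 : finrank ℂ (Submodule.map (ad ℂ L e) n) = finrank ℂ n := by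
    rw [← LinearMap.range_domRestrict]
    refine LinearMap.finrank_range_of_inj (LinearMap.injective_domRestrict_iff.mpr ?_)
    exact disjoint_iff.mpr hA4
  have h5 := LinearMap.BilinForm.finrank_orthogonal
    (LieAlgebra.IsKilling.killingForm_nondegenerate ℂ L) m
  have h6 := Submodule.finrank_le m
  rw [hinf, finrank_bot] at h1
  rw [hs1, hs2, finrank_bot] at h2
  exact Submodule.eq_top_of_finrank_eq (by omega)

end GradedLie

/-- **Theorem 3.5 (Sadaka).** Let `(𝔪, 𝔫)` be an `e`-admissible pair relative to a
`ℤ`-grading `Γ` with `e ∈ 𝔤_a` (`a > 1`), and let `𝔰` be a `Γ`-graded subspace of `𝔪^⊥`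
complementary to `[𝔫, e]` in `𝔪^⊥`.  Then for every `x ∈ e + 𝔰` one has `[𝔤, x] + 𝔰 = 𝔤`,
and for every `x ∈ e + 𝔪^⊥` one has `[𝔤, x] + 𝔪^⊥ = 𝔤`; i.e. the affine subvarieties
`χ + κ(𝔰)` and `χ + κ(𝔪^⊥)` of `𝔤*` are transverse to the coadjoint orbits. -/
theorem stmt_7 {L : Type*} [LieRing L] [LieAlgebra ℂ L]
    [FiniteDimensional ℂ L] [LieAlgebra.IsSimple ℂ L]
    (e : L) (he : IsNilpotent (ad ℂ L e))
    (g : ℤ → Submodule ℂ L)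
    (hInt : DirectSum.IsInternal g)
    (hbr : ∀ i j : ℤ, ∀ x ∈ g i, ∀ y ∈ g j, ⁅x, y⁆ ∈ g (i + j))
    (a : ℤ) (ha : 1 < a) (hea : e ∈ g a)
    (m n : Submodule ℂ L) (hp : IsAdmissiblePair g e a m n)
    (s : Submodule ℂ L)
    (hsg : s = (⨆ j : ℤ, g j ⊓ s))
    (hs0 : s ≤ LinearMap.BilinForm.orthogonal (killingForm ℂ L) m)
    (hs1 : s ⊓ Submodule.map (ad ℂ L e) n = ⊥)
    (hs2 : s ⊔ Submodule.map (ad ℂ L e) n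
      = LinearMap.BilinForm.orthogonal (killingForm ℂ L) m) :
    (∀ y ∈ s, LinearMap.range (ad ℂ L (e + y)) ⊔ s = ⊤) ∧
    (∀ y ∈ LinearMap.BilinForm.orthogonal (killingForm ℂ L) m,
      LinearMap.range (ad ℂ L (e + y)) ⊔
        LinearMap.BilinForm.orthogonal (killingForm ℂ L) m = ⊤) := by
  obtain ⟨P, hPmem, hP1, hP0, hPsum⟩ := hInt.exists_proj
  have hm : (⨆ j ≤ -a, g j) ≤ m := hp.2.2.2.2.1
  have hes := range_ad_sup_eq_top_of_admissible hp hs0 hs1 hs2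
  have key : ∀ y ∈ LinearMap.BilinForm.orthogonal (killingForm ℂ L) m,
      LinearMap.range (ad ℂ L (e + y)) ⊔ s = ⊤ := fun y hy =>
    range_ad_add_sup_eq_top hInt hbr hPmem hP1 hP0 hPsum hea hsg hes fun _ hj =>
      proj_eq_zero_of_mem_orthogonal hInt hbr hPmem hP0 hPsum hm hy hj
  exact ⟨fun y hy => key y (hs0 hy), fun y hy =>
    top_le_iff.mp ((key y hy).ge.trans (sup_le_sup_left hs0 _))⟩
end
end

section
/- Let (𝔪,𝔫) be an e-admissible pair relative to a ℤ-grading Γ with e ∈ 𝔤_a (a > 1). Then for every x ∈ 𝔫 and every y ∈ 𝔪^⊥, the element exp(ad x)(e + y) belongs to e + 𝔪^⊥ (here ad x is nilpotent, so exp(ad x) is a well-defined automorphism of 𝔤). Consequently, the unipotent group with Lie algebra 𝔫 preserves the affine subspace e + 𝔪^⊥ under the adjoint action. -/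
open Module LieAlgebra

noncomputable section

variable {L : Type*} [LieRing L] [LieAlgebra ℂ L]

/-- The Killing orthogonal of a submodule stable under `ad x` is stable under `ad x`. -/
theorem lie_mem_killingForm_orthogonal {m : Submodule ℂ L} {x : L} (hx : ∀ z ∈ m, ⁅x, z⁆ ∈ m)
    {y : L} (hy : y ∈ LinearMap.BilinForm.orthogonal (killingForm ℂ L) m) :
    ⁅x, y⁆ ∈ LinearMap.BilinForm.orthogonal (killingForm ℂ L) m := by
  intro z hz
  have hzx : ⁅z, x⁆ ∈ m := by
    rw [← lie_skew]
    exact m.neg_mem (hx z hz)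
  exact (LieModule.traceForm_apply_lie_apply ℂ L L z x y).symm.trans (hy _ hzx)

/-- If an endomorphism `f` preserves `W` and maps `e` into `W`, then the truncated exponential
of `f` maps `e + W` into itself. -/
theorem sum_range_factorial_inv_smul_pow_apply_add_sub_mem {V : Type*} [AddCommGroup V]
    [Module ℂ V] {f : Module.End ℂ V} {W : Submodule ℂ V} {e y : V}
    (hW : ∀ w ∈ W, f w ∈ W) (he : f e ∈ W) (hy : y ∈ W) (N : ℕ) :
    (∑ i ∈ Finset.range (N + 1), ((Nat.factorial i : ℂ))⁻¹ • f ^ i) (e + y) - e ∈ W := by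
  have hpow : ∀ i : ℕ, (f ^ (i + 1)) (e + y) ∈ W := by
    intro i
    induction i with
    | zero => simpa using W.add_mem he (hW y hy)
    | succ k ih =>
      rw [pow_succ']
      exact hW _ ih
  have hsum : (∑ i ∈ Finset.range N,
      ((Nat.factorial (i + 1) : ℂ))⁻¹ • (f ^ (i + 1)) (e + y)) + y ∈ W :=
    W.add_mem (W.sum_mem fun i _ => W.smul_mem _ (hpow i)) hy
  rw [LinearMap.sum_apply, Finset.sum_range_succ']
  convert hsum using 1
  simp only [LinearMap.smul_apply, Nat.factorial_zero, Nat.cast_one, inv_one, pow_zero, one_smul,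
    Module.End.one_apply]
  abel

/-- **Lemma 3.6 (Sadaka).** Let `(𝔪, 𝔫)` be an `e`-admissible pair relative to a
`ℤ`-grading `Γ` with `e ∈ 𝔤_a` (`a > 1`).  For every `x ∈ 𝔫` and every `y ∈ 𝔪^⊥`, the
element `exp(ad x)(e + y)` lies in `e + 𝔪^⊥`.  Here `ad x` is nilpotent, so
`exp (ad x) = ∑_{i<N} (1/i!) (ad x)^i` for any `N` with `(ad x)^N = 0`; consequently the
unipotent group with Lie algebra `𝔫` preserves `e + 𝔪^⊥` under the adjoint action. -/
theorem stmt_8 {L : Type*} [LieRing L] [LieAlgebra ℂ L]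
    [FiniteDimensional ℂ L] [LieAlgebra.IsSimple ℂ L]
    (e : L) (he : IsNilpotent (ad ℂ L e))
    (g : ℤ → Submodule ℂ L)
    (hInt : DirectSum.IsInternal g)
    (hbr : ∀ i j : ℤ, ∀ x ∈ g i, ∀ y ∈ g j, ⁅x, y⁆ ∈ g (i + j))
    (a : ℤ) (ha : 1 < a) (hea : e ∈ g a)
    (m n : Submodule ℂ L) (hp : IsAdmissiblePair g e a m n) :
    ∀ x ∈ n, ∀ y ∈ LinearMap.BilinForm.orthogonal (killingForm ℂ L) m,
      ∀ N : ℕ, (ad ℂ L x) ^ N = 0 →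
        (∑ i ∈ Finset.range N, ((Nat.factorial i : ℂ))⁻¹ • (ad ℂ L x) ^ i) (e + y) - e
          ∈ LinearMap.BilinForm.orthogonal (killingForm ℂ L) m := by
  obtain ⟨-, -, -, -, -, -, -, hA3, -, hA5, -⟩ := hp
  intro x hx y hy N hN
  have hxe : ad ℂ L x e ∈ LinearMap.BilinForm.orthogonal (killingForm ℂ L) m := by
    have hex : ad ℂ L e x ∈ Submodule.map (ad ℂ L e) n := Submodule.mem_map_of_mem hx
    rw [← hA3] at hex
    rw [ad_apply, ← lie_skew]
    exact Submodule.neg_mem _ hex.1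
  cases N with
  | zero =>
    have he0 : e = 0 := by simpa using LinearMap.congr_fun hN e
    simp [he0]
  | succ k =>
    exact sum_range_factorial_inv_smul_pow_apply_add_sub_mem
      (fun w hw => lie_mem_killingForm_orthogonal (hA5 x hx) hw) hxe hy k
end
end

section
/- Let (𝔪,𝔫) be an e-admissible pair relative to a ℤ-grading Γ with e ∈ 𝔤_a (a > 1), and let 𝔰 be a Γ-graded subspace of 𝔪^⊥ complementary to [𝔫, e] in 𝔪^⊥. Then for every x ∈ e + 𝔰 one has [x, 𝔰^⊥] ∩ 𝔰 = 0. -/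
open Module LieAlgebra

noncomputable section

variable {L : Type*} [LieRing L] [LieAlgebra ℂ L]

section GradedLie

open DirectSum

variable {K M : Type*} [Field K] [LieRing M] [LieAlgebra K M] {g : ℤ → Submodule K M}

/-- If `p` is a complement of the range of `ad e`, then its orthogonal meets the centralizer of `e`
trivially. -/
lemma eq_zero_of_mem_orthogonal_killingForm_of_lie_eq_zero [IsKilling K M] {e : M}
    {p : Submodule K M} (hp : p ⊔ LinearMap.range (ad K M e) = ⊤) {z : M}
    (hz : z ∈ LinearMap.BilinForm.orthogonal (killingForm K M) p) (hez : ⁅e, z⁆ = 0) : z = 0 := by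
  refine (IsKilling.killingForm_nondegenerate K M).2 _ fun y ↦ ?_
  obtain ⟨u, hu, _, ⟨w, rfl⟩, rfl⟩ := Submodule.mem_sup.mp (hp ▸ Submodule.mem_top : y ∈ _)
  have h : killingForm K M ⁅e, w⁆ z = 0 := by
    rw [← lie_skew, map_neg, LinearMap.neg_apply, LieModule.traceForm_apply_lie_apply, hez, map_zero,
      neg_zero]
  rw [map_add, LinearMap.add_apply, ad_apply, h, add_zero]
  exact hz u hu

/-- Homogeneous elements whose degrees do not add up to zero are orthogonal for the Killing
form. -/
lemma killingForm_eq_zero_of_mem_of_add_ne_zero (hInt : IsInternal g) [FiniteDimensional K M]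
    (hbr : ∀ i j : ℤ, ∀ x ∈ g i, ∀ y ∈ g j, ⁅x, y⁆ ∈ g (i + j))
    {i j : ℤ} (hij : i + j ≠ 0) {x y : M} (hx : x ∈ g i) (hy : y ∈ g j) :
    killingForm K M x y = 0 := by
  rw [killingForm_apply_apply]
  refine LinearMap.trace_eq_zero_of_mapsTo_ne hInt (fun k ↦ i + (j + k)) (fun k ↦ by omega) ?_
  intro k z hz
  exact hbr _ _ x hx _ (hbr _ _ y hy z hz)

variable [Decomposition g]

/-- A submodule spanned by its homogeneous elements contains the components of its elements. -/
lemma decompose_mem_of_eq_iSup_inf {p : Submodule K M} (hp : p = ⨆ j, g j ⊓ p)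
    {x : M} (hx : x ∈ p) (i : ℤ) : (decompose g x i : M) ∈ p := by
  rw [hp] at hx
  induction hx using Submodule.iSup_induction' with
  | mem j x hx =>
    by_cases h : j = i
    · subst h
      rw [decompose_of_mem_same g hx.1]
      exact hx.2
    · rw [decompose_of_mem_ne g hx.1 h]
      exact p.zero_mem
  | zero => simp
  | add x y _ _ hx hy =>
    rw [decompose_add, DirectSum.add_apply, Submodule.coe_add]
    exact p.add_mem hx hy

/-- The top component of a bracket is the bracket of the top components. -/
lemma decompose_lie_of_forall_lt (hbr : ∀ i j : ℤ, ∀ x ∈ g i, ∀ y ∈ g j, ⁅x, y⁆ ∈ g (i + j))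
    {x y : M} {p q : ℤ} (hx : ∀ i, p < i → (decompose g x i : M) = 0)
    (hy : ∀ j, q < j → (decompose g y j : M) = 0) :
    (decompose g ⁅x, y⁆ (p + q) : M) = ⁅(decompose g x p : M), (decompose g y q : M)⁆ := by
  classical
  have key : ∀ i j, (decompose g ⁅(decompose g x i : M), (decompose g y j : M)⁆ (p + q) : M) =
      if i = p then if j = q then ⁅(decompose g x p : M), (decompose g y q : M)⁆ else 0 else 0 := by
    intro i j
    have hmem := hbr i j _ (decompose g x i).2 _ (decompose g y j).2
    by_cases h : i + j = p + q
    · rw [← h, decompose_of_mem_same g hmem]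
      rcases lt_trichotomy i p with hi | rfl | hi
      · rw [hy j (by omega), if_neg (by omega), lie_zero]
      · obtain rfl : j = q := by omega
        simp
      · rw [hx i hi, if_neg (by omega), zero_lie]
    · rw [decompose_of_mem_ne g hmem h]
      split_ifs <;> first | rfl | omega
  have hsum : ⁅x, y⁆ = ∑ i ∈ (decompose g x).support, ∑ j ∈ (decompose g y).support,
      ⁅(decompose g x i : M), (decompose g y j : M)⁆ := by
    rw [← sum_lie_sum, sum_support_decompose, sum_support_decompose]
  simp only [hsum, decompose_sum, DirectSum.sum_apply, AddSubmonoidClass.coe_finsetSum, key,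
    Finset.sum_ite_eq', Finset.sum_ite_irrel, Finset.sum_const_zero]
  split_ifs with hp hq
  · rfl
  · simp [DFinsupp.notMem_support_iff.mp hq]
  · simp [DFinsupp.notMem_support_iff.mp hp]

variable [FiniteDimensional K M]

lemma killingForm_decompose_left (hInt : IsInternal g)
    (hbr : ∀ i j : ℤ, ∀ x ∈ g i, ∀ y ∈ g j, ⁅x, y⁆ ∈ g (i + j)) (x y : M) (i : ℤ) :
    killingForm K M (decompose g x i) y = killingForm K M x (decompose g y (-i)) := by
  classical
  have h1 : killingForm K M (decompose g x i) y =
      killingForm K M (decompose g x i) (decompose g y (-i)) := by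
    conv_lhs => rw [← sum_support_decompose g y, map_sum]
    rw [Finset.sum_eq_single (-i)]
    · intro j _ hj
      exact killingForm_eq_zero_of_mem_of_add_ne_zero hInt hbr (by omega)
        (decompose g x i).2 (decompose g y j).2
    · intro h
      simp [DFinsupp.notMem_support_iff.mp h]
  have h2 : killingForm K M x (decompose g y (-i)) =
      killingForm K M (decompose g x i) (decompose g y (-i)) := by
    conv_lhs => rw [← sum_support_decompose g x, map_sum, LinearMap.sum_apply]
    rw [Finset.sum_eq_single i]
    · intro j _ hj
      exact killingForm_eq_zero_of_mem_of_add_ne_zero hInt hbr (by omega)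
        (decompose g x j).2 (decompose g y (-i)).2
    · intro h
      simp [DFinsupp.notMem_support_iff.mp h]
  rw [h1, h2]

/-- The orthogonal of a graded subspace contains the components of its elements. -/
lemma decompose_mem_orthogonal_killingForm (hInt : IsInternal g)
    (hbr : ∀ i j : ℤ, ∀ x ∈ g i, ∀ y ∈ g j, ⁅x, y⁆ ∈ g (i + j))
    {p : Submodule K M} (hp : p = ⨆ j, g j ⊓ p) {x : M}
    (hx : x ∈ LinearMap.BilinForm.orthogonal (killingForm K M) p) (i : ℤ) :
    (decompose g x i : M) ∈ LinearMap.BilinForm.orthogonal (killingForm K M) p := by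
  intro y hy
  have := killingForm_decompose_left hInt hbr y x (-i)
  rw [neg_neg] at this
  rw [← this]
  exact hx _ (decompose_mem_of_eq_iSup_inf hp hy _)

/-- The orthogonal of a subspace containing all elements of degree at most `-a` has no component
of degree at least `a`. -/
lemma decompose_eq_zero_of_mem_orthogonal_killingForm [IsKilling K M] (hInt : IsInternal g)
    (hbr : ∀ i j : ℤ, ∀ x ∈ g i, ∀ y ∈ g j, ⁅x, y⁆ ∈ g (i + j))
    {p : Submodule K M} {a : ℤ} (hp : ⨆ j ≤ -a, g j ≤ p) {x : M}
    (hx : x ∈ LinearMap.BilinForm.orthogonal (killingForm K M) p) {i : ℤ} (hi : a ≤ i) :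
    (decompose g x i : M) = 0 := by
  refine (IsKilling.killingForm_nondegenerate K M).1 _ fun y ↦ ?_
  rw [killingForm_decompose_left hInt hbr, LieModule.traceForm_comm]
  refine hx _ (hp ?_)
  exact Submodule.mem_iSup_of_mem (-i) (Submodule.mem_iSup_of_mem (by omega) (decompose g y (-i)).2)

end GradedLie

/-- **Lemma 3.10 (Sadaka).** Let `(𝔪, 𝔫)` be an `e`-admissible pair relative to a
`ℤ`-grading `Γ` with `e ∈ 𝔤_a` (`a > 1`), and let `𝔰` be a `Γ`-graded subspace of `𝔪^⊥`
complementary to `[𝔫, e]` in `𝔪^⊥`.  Then for every `x ∈ e + 𝔰` one has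
`[x, 𝔰^⊥] ∩ 𝔰 = 0`. -/
theorem stmt_9 {L : Type*} [LieRing L] [LieAlgebra ℂ L]
    [FiniteDimensional ℂ L] [LieAlgebra.IsSimple ℂ L]
    (e : L) (he : IsNilpotent (ad ℂ L e))
    (g : ℤ → Submodule ℂ L)
    (hInt : DirectSum.IsInternal g)
    (hbr : ∀ i j : ℤ, ∀ x ∈ g i, ∀ y ∈ g j, ⁅x, y⁆ ∈ g (i + j))
    (a : ℤ) (ha : 1 < a) (hea : e ∈ g a)
    (m n : Submodule ℂ L) (hp : IsAdmissiblePair g e a m n)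
    (s : Submodule ℂ L)
    (hsg : s = (⨆ j : ℤ, g j ⊓ s))
    (hs0 : s ≤ LinearMap.BilinForm.orthogonal (killingForm ℂ L) m)
    (hs1 : s ⊓ Submodule.map (ad ℂ L e) n = ⊥)
    (hs2 : s ⊔ Submodule.map (ad ℂ L e) n
      = LinearMap.BilinForm.orthogonal (killingForm ℂ L) m) :
    ∀ y ∈ s,
      Submodule.map (ad ℂ L (e + y))
          (LinearMap.BilinForm.orthogonal (killingForm ℂ L) s) ⊓ s = ⊥ := by
  classical
  obtain ⟨-, -, -, -, hgm, -, -, hA3, hA4, -, hA6⟩ := hp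
  let _ : DirectSum.Decomposition g := hInt.chooseDecomposition
  have hse : s ⊓ LinearMap.range (ad ℂ L e) = ⊥ := by
    rw [eq_bot_iff, ← hs1, ← hA3]
    exact le_inf inf_le_left (inf_le_inf_right _ hs0)
  have htop : s ⊔ LinearMap.range (ad ℂ L e) = ⊤ := by
    apply Submodule.eq_top_of_finrank_eq
    have hn : finrank ℂ (Submodule.map (ad ℂ L e) n) = finrank ℂ n := by
      have hinj : Function.Injective ((ad ℂ L e : L →ₗ[ℂ] L).domRestrict n) := by
        rw [← LinearMap.ker_eq_bot, LinearMap.ker_domRestrict,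
          ← Submodule.disjoint_iff_comap_eq_bot, disjoint_iff]
        exact hA4
      rw [← LinearMap.finrank_range_of_inj hinj, LinearMap.range_domRestrict]
    have h1 := Submodule.finrank_sup_add_finrank_inf_eq s (Submodule.map (ad ℂ L e) n)
    have h2 := Submodule.finrank_sup_add_finrank_inf_eq s (LinearMap.range (ad ℂ L e))
    rw [hs1, hs2, LinearMap.BilinForm.finrank_orthogonal
      (IsKilling.killingForm_nondegenerate ℂ L), finrank_bot, hn] at h1
    rw [hse, finrank_bot] at h2
    have h3 := LinearMap.finrank_range_add_finrank_ker (ad ℂ L e)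
    have h4 := Submodule.finrank_le m
    omega
  intro y hy
  have hy0 : ∀ i, a ≤ i → (DirectSum.decompose g y i : L) = 0 := fun i hi ↦
    decompose_eq_zero_of_mem_orthogonal_killingForm hInt hbr hgm (hs0 hy) hi
  rw [eq_bot_iff]
  rintro _ ⟨⟨z, hz, rfl⟩, hs⟩
  rw [ad_apply] at hs ⊢
  suffices hz0 : z = 0 by simp [hz0]
  by_contra hz0
  have hne : (DirectSum.decompose g z).support.Nonempty := by
    rw [Finset.nonempty_iff_ne_empty, Ne, DFinsupp.support_eq_empty]
    exact fun h ↦ hz0 ((DirectSum.decompose g).injective (h.trans (DirectSum.decompose_zero g).symm))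
  obtain ⟨k, hk, hmax⟩ := Finset.exists_max_image _ id hne
  have hlie := decompose_lie_of_forall_lt hbr (x := e + y) (y := z) (p := a) (q := k)
    (fun i hi ↦ by
      rw [DirectSum.decompose_add, DirectSum.add_apply, Submodule.coe_add, hy0 i hi.le,
        DirectSum.decompose_of_mem_ne g hea hi.ne, add_zero])
    (fun j hj ↦ by
      by_contra h
      exact hj.not_ge (hmax j (DFinsupp.mem_support_iff.mpr fun h' ↦ h (by simp [h']))))
  rw [DirectSum.decompose_add, DirectSum.add_apply, Submodule.coe_add, hy0 a le_rfl,
    DirectSum.decompose_of_mem_same g hea, add_zero] at hlie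
  have hezs : ⁅e, (DirectSum.decompose g z k : L)⁆ ∈ s ⊓ LinearMap.range (ad ℂ L e) :=
    ⟨hlie ▸ decompose_mem_of_eq_iSup_inf hsg hs _, _, rfl⟩
  rw [hse, Submodule.mem_bot] at hezs
  refine DFinsupp.mem_support_iff.mp hk (Subtype.ext ?_)
  exact eq_zero_of_mem_orthogonal_killingForm_of_lie_eq_zero htop
    (decompose_mem_orthogonal_killingForm hInt hbr hsg hz k) hezs
end
end

section
/- If two e-admissible pairs (𝔪₁,𝔫₁) and (𝔪₂,𝔫₂) are comparable, then the algebras H(𝔪₁,𝔫₁) and H(𝔪₂,𝔫₂) are isomorphic. -/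
open Module LieAlgebra

noncomputable section

variable {L : Type*} [LieRing L] [LieAlgebra ℂ L]

/-- `g : ℤ → Submodule ℂ L` is a `ℤ`-grading of the Lie algebra `L`. -/
def IsZGrading (g : ℤ → Submodule ℂ L) : Prop :=
  DirectSum.IsInternal g ∧ ∀ i j : ℤ, ∀ x ∈ g i, ∀ y ∈ g j, ⁅x, y⁆ ∈ g (i + j)

/-- Two `e`-admissible pairs are *comparable* if they are `e`-admissible relative to one
common `ℤ`-grading `Γ` and one is squeezed inside the other
(`𝔪 ⊆ 𝔪′ ⊆ 𝔫′ ⊆ 𝔫` or `𝔪′ ⊆ 𝔪 ⊆ 𝔫 ⊆ 𝔫′`). -/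
def ComparablePairs (e : L) (p q : Submodule ℂ L × Submodule ℂ L) : Prop :=
  ∃ (g : ℤ → Submodule ℂ L) (a : ℤ), IsZGrading g ∧ 1 < a ∧ e ∈ g a ∧
    IsAdmissiblePair g e a p.1 p.2 ∧ IsAdmissiblePair g e a q.1 q.2 ∧
    ((p.1 ≤ q.1 ∧ q.1 ≤ q.2 ∧ q.2 ≤ p.2) ∨ (q.1 ≤ p.1 ∧ p.1 ≤ p.2 ∧ p.2 ≤ q.2))

/-- Two `e`-admissible pairs are *equivalent* if they are joined by a finite chain of
`e`-admissible pairs in which consecutive pairs are comparable. -/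
def EquivalentPairs (e : L) : (Submodule ℂ L × Submodule ℂ L) →
    (Submodule ℂ L × Submodule ℂ L) → Prop :=
  Relation.ReflTransGen (ComparablePairs e)

/-- The universal enveloping algebra of `𝔤`. -/
abbrev UEA (L : Type*) [LieRing L] [LieAlgebra ℂ L] := UniversalEnvelopingAlgebra ℂ L

/-- The left ideal `I(𝔪)` of `U(𝔤)` generated by the elements `x − χ(x)`, `x ∈ 𝔪`,
where `χ = ⟨e, ·⟩`. -/
def lideal (e : L) (m : Submodule ℂ L) : Submodule (UEA L) (UEA L) :=
  Submodule.span (UEA L)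
    ((fun x : L => (UniversalEnvelopingAlgebra.ι ℂ x : UEA L)
        - algebraMap ℂ (UEA L) (killingForm ℂ L e x)) '' (m : Set L))

/-- `I(𝔪)`, viewed as a `ℂ`-subspace of `U(𝔤)`. -/
def lidealC (e : L) (m : Submodule ℂ L) : Submodule ℂ (UEA L) :=
  (lideal e m).restrictScalars ℂ

/-- The `ℂ`-subspace of `U(𝔤)` of elements `u` with `[ι x, u] ∈ I(𝔪)` for all `x ∈ 𝔫`
(i.e. elements whose class in `Q(𝔪)` is `ad 𝔫`-invariant). -/
def invSet (e : L) (m n : Submodule ℂ L) : Submodule ℂ (UEA L) :=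
  ⨅ x ∈ n, Submodule.comap
    (LinearMap.mulLeft ℂ ((UniversalEnvelopingAlgebra.ι ℂ x : UEA L))
      - LinearMap.mulRight ℂ ((UniversalEnvelopingAlgebra.ι ℂ x : UEA L)))
    (lidealC e m)

/-- The W-algebra `H(𝔪, 𝔫) = Q(𝔪)^{ad 𝔫}`, as a `ℂ`-subspace of `Q(𝔪) = U(𝔤)/I(𝔪)`. -/
def Hsub (e : L) (m n : Submodule ℂ L) : Submodule ℂ (UEA L ⧸ lidealC e m) :=
  (invSet e m n).map (lidealC e m).mkQ

/-- The statement that the W-algebras `H(𝔪₁, 𝔫₁)` and `H(𝔪₂, 𝔫₂)` are isomorphic as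
unital `ℂ`-algebras: there is a `ℂ`-linear equivalence preserving the class of `1` and
compatible with the multiplications induced from `U(𝔤)`. -/
def WAlgebraIso (e : L) (m₁ n₁ m₂ n₂ : Submodule ℂ L) : Prop :=
  ∃ φ : ↥(Hsub e m₁ n₁) ≃ₗ[ℂ] ↥(Hsub e m₂ n₂),
    (∀ p : ↥(Hsub e m₁ n₁), (p : UEA L ⧸ lidealC e m₁) = Submodule.Quotient.mk 1 →
      ((φ p : UEA L ⧸ lidealC e m₂) = Submodule.Quotient.mk 1)) ∧
    ∀ p q r : ↥(Hsub e m₁ n₁),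
      (∃ u v : UEA L, u ∈ invSet e m₁ n₁ ∧ v ∈ invSet e m₁ n₁ ∧
        (p : UEA L ⧸ lidealC e m₁) = Submodule.Quotient.mk u ∧
        (q : UEA L ⧸ lidealC e m₁) = Submodule.Quotient.mk v ∧
        (r : UEA L ⧸ lidealC e m₁) = Submodule.Quotient.mk (u * v)) →
      (∃ u' v' : UEA L, u' ∈ invSet e m₂ n₂ ∧ v' ∈ invSet e m₂ n₂ ∧
        (φ p : UEA L ⧸ lidealC e m₂) = Submodule.Quotient.mk u' ∧
        (φ q : UEA L ⧸ lidealC e m₂) = Submodule.Quotient.mk v' ∧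
        (φ r : UEA L ⧸ lidealC e m₂) = Submodule.Quotient.mk (u' * v'))

/-! ### Linear maps with `[D, Y] = 1` -/

section Heisenberg

variable {M : Type*} [AddCommGroup M] [Module ℂ M]

theorem pow_apply_of_commutator_eq_one {D Y : Module.End ℂ M}
    (h : ∀ u, D (Y u) = Y (D u) + u) (k : ℕ) (u : M) :
    (D ^ (k + 1)) (Y u) = Y ((D ^ (k + 1)) u) + ((k : ℂ) + 1) • (D ^ k) u := by
  induction k generalizing u with
  | zero => simp [h]
  | succ k ih =>
    have h1 : ∀ (j : ℕ) (w : M), (D ^ (j + 1)) w = (D ^ j) (D w) := fun j w => by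
      rw [pow_succ, Module.End.mul_apply]
    rw [h1 (k + 1), h, map_add, ih, h1 (k + 1) u, h1 k u]
    push_cast
    module

theorem eq_zero_of_commutator_eq_one {D Y : Module.End ℂ M}
    (h : ∀ u, D (Y u) = Y (D u) + u) {u : M} (hnil : ∃ k, (D ^ k) u = 0)
    (hu : D (Y u) = 0) : u = 0 := by
  obtain ⟨k, hk⟩ := hnil
  induction k with
  | zero => simpa using hk
  | succ k ih =>
    apply ih
    have h1 := pow_apply_of_commutator_eq_one h k u
    rw [hk, map_zero, zero_add, pow_succ, Module.End.mul_apply, hu, map_zero] at h1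
    exact (smul_eq_zero.mp h1.symm).resolve_left (by exact_mod_cast Nat.succ_ne_zero k)

theorem exists_mem_ker_of_commutator_eq_one {D Y : Module.End ℂ M}
    (h : ∀ u, D (Y u) = Y (D u) + u) {v : M} (hnil : ∃ k, (D ^ k) v = 0) :
    ∃ u w, D u = 0 ∧ u = v + Y w := by
  obtain ⟨k, hk⟩ := hnil
  induction k generalizing v with
  | zero => exact ⟨0, 0, by simp, by simpa using hk.symm⟩
  | succ k ih =>
    rcases k with _ | k
    · exact ⟨v, 0, by simpa using hk, by simp⟩
    have hne : ((k : ℂ) + 1) ≠ 0 := by exact_mod_cast Nat.succ_ne_zero k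
    obtain ⟨u, w, hu, huw⟩ := ih (v := v - ((k : ℂ) + 1)⁻¹ • Y (D v)) (by
      have h1 := pow_apply_of_commutator_eq_one h k (D v)
      rw [pow_succ, Module.End.mul_apply] at hk
      rw [hk, map_zero, zero_add, ← Module.End.mul_apply (D ^ k) D, ← pow_succ] at h1
      rw [map_sub, map_smul, h1, smul_smul, inv_mul_cancel₀ hne, one_smul, sub_self])
    refine ⟨u, w - ((k : ℂ) + 1)⁻¹ • D v, hu, ?_⟩
    rw [huw, map_sub, map_smul]
    abel

theorem mem_of_commutator_sub_one_mem {I : Submodule ℂ M} {D Y : Module.End ℂ M}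
    (hD : I ≤ I.comap D) (hY : I ≤ I.comap Y) (h : ∀ u, D (Y u) - Y (D u) - u ∈ I)
    (hnil : ∀ u, ∃ k, (D ^ k) u = 0) {u w : M} (hu : D u ∈ I) (hw : u - Y w ∈ I) : u ∈ I := by
  have h' : ∀ q, I.mapQ I D hD (I.mapQ I Y hY q) = I.mapQ I Y hY (I.mapQ I D hD q) + q := by
    intro q
    obtain ⟨q, rfl⟩ := I.mkQ_surjective q
    rw [← sub_eq_zero, ← sub_sub]
    exact (Submodule.Quotient.mk_eq_zero I).mpr (h q)
  have hw' : w ∈ I := by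
    rw [← Submodule.Quotient.mk_eq_zero I]
    refine eq_zero_of_commutator_eq_one h' ?_ ?_
    · obtain ⟨k, hk⟩ := hnil w
      refine ⟨k, ?_⟩
      rw [← Submodule.mapQ_pow, Submodule.mapQ_apply, hk, Submodule.Quotient.mk_zero]
    · rw [Submodule.mapQ_apply, Submodule.mapQ_apply, Submodule.Quotient.mk_eq_zero]
      have := sub_mem hu (hD hw)
      rwa [map_sub, sub_sub_cancel] at this
  simpa using add_mem hw (hY hw')

theorem exists_mem_of_commutator_sub_one_mem {I : Submodule ℂ M} {D Y : Module.End ℂ M}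
    (hD : I ≤ I.comap D) (hY : I ≤ I.comap Y) (h : ∀ u, D (Y u) - Y (D u) - u ∈ I)
    (hnil : ∀ u, ∃ k, (D ^ k) u = 0) (v : M) : ∃ u w, D u ∈ I ∧ u - v - Y w ∈ I := by
  have h' : ∀ q, I.mapQ I D hD (I.mapQ I Y hY q) = I.mapQ I Y hY (I.mapQ I D hD q) + q := by
    intro q
    obtain ⟨q, rfl⟩ := I.mkQ_surjective q
    rw [← sub_eq_zero, ← sub_sub]
    exact (Submodule.Quotient.mk_eq_zero I).mpr (h q)
  obtain ⟨u, w, hu, huw⟩ := exists_mem_ker_of_commutator_eq_one h' (v := I.mkQ v) (by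
    obtain ⟨k, hk⟩ := hnil v
    refine ⟨k, ?_⟩
    rw [← Submodule.mapQ_pow, Submodule.mkQ_apply, Submodule.mapQ_apply, hk,
      Submodule.Quotient.mk_zero])
  obtain ⟨u, rfl⟩ := I.mkQ_surjective u
  obtain ⟨w, rfl⟩ := I.mkQ_surjective w
  refine ⟨u, w, (Submodule.Quotient.mk_eq_zero I).mp hu, ?_⟩
  rw [← Submodule.Quotient.mk_eq_zero I, Submodule.Quotient.mk_sub, Submodule.Quotient.mk_sub,
    sub_sub, sub_eq_zero]
  exact huw

end Heisenberg

/-! ### The adjoint action on the enveloping algebra -/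

attribute [local instance] LieRing.ofAssociativeRing

/-- The inner derivation `u ↦ x u - u x` of the enveloping algebra. -/
def adU (x : L) : Module.End ℂ (UEA L) :=
  LinearMap.mulLeft ℂ (UniversalEnvelopingAlgebra.ι ℂ x : UEA L)
    - LinearMap.mulRight ℂ (UniversalEnvelopingAlgebra.ι ℂ x : UEA L)

theorem adU_apply (x : L) (u : UEA L) :
    adU x u = UniversalEnvelopingAlgebra.ι ℂ x * u - u * UniversalEnvelopingAlgebra.ι ℂ x := rfl

theorem uea_ι_lie (x y : L) :
    (UniversalEnvelopingAlgebra.ι ℂ ⁅x, y⁆ : UEA L) =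
      UniversalEnvelopingAlgebra.ι ℂ x * UniversalEnvelopingAlgebra.ι ℂ y
        - UniversalEnvelopingAlgebra.ι ℂ y * UniversalEnvelopingAlgebra.ι ℂ x := by
  rw [LieHom.map_lie]
  rfl

theorem adU_ι (x y : L) :
    adU x (UniversalEnvelopingAlgebra.ι ℂ y) = UniversalEnvelopingAlgebra.ι ℂ ⁅x, y⁆ := by
  rw [uea_ι_lie, adU_apply]

theorem adU_mul (x : L) (u v : UEA L) : adU x (u * v) = adU x u * v + u * adU x v := by
  simp only [adU_apply]
  noncomm_ring

theorem adU_algebraMap (x : L) (c : ℂ) : adU x (algebraMap ℂ (UEA L) c) = 0 := by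
  rw [adU_apply, Algebra.commutes, sub_self]

theorem adU_lie (x y : L) (u : UEA L) :
    adU ⁅x, y⁆ u = adU x (adU y u) - adU y (adU x u) := by
  simp only [adU_apply, uea_ι_lie]
  noncomm_ring

theorem adU_pow_mul_eq_zero (x : L) (n : ℕ) {u v : UEA L} {k l : ℕ} (hkl : k + l ≤ n)
    (hu : (adU x ^ k) u = 0) (hv : (adU x ^ l) v = 0) : (adU x ^ n) (u * v) = 0 := by
  induction n generalizing u v k l with
  | zero =>
    obtain rfl : k = 0 := by omega
    have hu' : u = 0 := by simpa using hu
    simp [hu']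
  | succ n ih =>
    rcases k with _ | k
    · have hu' : u = 0 := by simpa using hu
      simp [hu']
    rcases l with _ | l
    · have hv' : v = 0 := by simpa using hv
      simp [hv']
    rw [pow_succ, Module.End.mul_apply, adU_mul, map_add,
      ih (k := k) (l := l + 1) (by omega) (by rwa [pow_succ] at hu) hv,
      ih (k := k + 1) (l := l) (by omega) hu (by rwa [pow_succ] at hv), add_zero]

theorem uea_adjoin_range_ι :
    Algebra.adjoin ℂ (Set.range (UniversalEnvelopingAlgebra.ι ℂ : L → UEA L)) = ⊤ := by
  set A := Algebra.adjoin ℂ (Set.range (UniversalEnvelopingAlgebra.ι ℂ : L → UEA L)) with hA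
  let f : L →ₗ⁅ℂ⁆ A :=
    { toFun := fun x => ⟨UniversalEnvelopingAlgebra.ι ℂ x, Algebra.subset_adjoin ⟨x, rfl⟩⟩
      map_add' := fun x y => Subtype.ext (map_add _ x y)
      map_smul' := fun c x => Subtype.ext (map_smul _ c x)
      map_lie' := fun {x y} => Subtype.ext (uea_ι_lie x y) }
  have h : A.val.comp (UniversalEnvelopingAlgebra.lift ℂ f) = AlgHom.id ℂ (UEA L) := by
    apply UniversalEnvelopingAlgebra.hom_ext
    ext x
    change ((UniversalEnvelopingAlgebra.lift ℂ f (UniversalEnvelopingAlgebra.ι ℂ x) : A) : UEA L) =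
      UniversalEnvelopingAlgebra.ι ℂ x
    rw [UniversalEnvelopingAlgebra.lift_ι_apply]
    rfl
  rw [eq_top_iff]
  intro u _
  have hu : A.val (UniversalEnvelopingAlgebra.lift ℂ f u) = u := DFunLike.congr_fun h u
  rw [← hu]
  exact Subtype.property _

/-- If `ad x` is locally nilpotent on `L`, it is so on the enveloping algebra. -/
theorem adU_locally_nilpotent {x : L} (hx : ∀ w : L, ∃ k, (ad ℂ L x ^ k) w = 0) (u : UEA L) :
    ∃ k, (adU x ^ k) u = 0 := by
  have hu : u ∈ Algebra.adjoin ℂ (Set.range (UniversalEnvelopingAlgebra.ι ℂ : L → UEA L)) := by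
    rw [uea_adjoin_range_ι]
    trivial
  induction hu using Algebra.adjoin_induction with
  | mem u hu =>
    obtain ⟨w, rfl⟩ := hu
    obtain ⟨k, hk⟩ := hx w
    have h : ∀ (j : ℕ) (w : L), (adU x ^ j) (UniversalEnvelopingAlgebra.ι ℂ w : UEA L)
        = UniversalEnvelopingAlgebra.ι ℂ ((ad ℂ L x ^ j) w) := by
      intro j
      induction j with
      | zero => intro w; simp
      | succ j ih =>
        intro w
        rw [pow_succ, Module.End.mul_apply, adU_ι, ih, pow_succ, Module.End.mul_apply, ad_apply]
    exact ⟨k, by rw [h, hk, map_zero]⟩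
  | algebraMap c => exact ⟨1, by rw [pow_one, adU_algebraMap]⟩
  | add u v _ _ hu hv =>
    obtain ⟨k, hk⟩ := hu
    obtain ⟨l, hl⟩ := hv
    refine ⟨k + l, ?_⟩
    have h1 : (adU x ^ (k + l)) u = 0 := by
      rw [add_comm, pow_add, Module.End.mul_apply, hk, map_zero]
    have h2 : (adU x ^ (k + l)) v = 0 := by
      rw [pow_add, Module.End.mul_apply, hl, map_zero]
    rw [map_add, h1, h2, add_zero]
  | mul u v _ _ hu hv =>
    obtain ⟨k, hk⟩ := hu
    obtain ⟨l, hl⟩ := hv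
    exact ⟨k + l, adU_pow_mul_eq_zero x _ le_rfl hk hl⟩

/-! ### The left ideals `I(𝔪)` -/

section Ideal

variable {e : L} {m n : Submodule ℂ L}

/-- The generator `x - χ(x)` of `I(𝔪)` attached to `x`. -/
def shiftedι (e x : L) : UEA L :=
  UniversalEnvelopingAlgebra.ι ℂ x - algebraMap ℂ (UEA L) (killingForm ℂ L e x)

theorem shiftedι_sub_smul (w y : L) (c : ℂ) :
    shiftedι e (w - c • y) = shiftedι e w - c • shiftedι e y := by
  simp only [shiftedι, map_sub, map_smul, Algebra.algebraMap_eq_smul_one, smul_eq_mul]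
  module

theorem adU_shiftedι {z w : L} (h : killingForm ℂ L e ⁅z, w⁆ = 0) :
    adU z (shiftedι e w) = shiftedι e ⁅z, w⁆ := by
  rw [shiftedι, map_sub, adU_ι, adU_algebraMap, shiftedι, h, map_zero]

theorem shiftedι_mul (w : L) (u : UEA L) :
    shiftedι e w * u = u * shiftedι e w + adU w u := by
  rw [shiftedι, sub_mul, mul_sub, Algebra.commutes, adU_apply]
  abel

theorem mul_shiftedι_mem (u : UEA L) {w : L} (hw : w ∈ m) : u * shiftedι e w ∈ lideal e m :=
  Submodule.smul_mem _ u (Submodule.subset_span ⟨w, hw, rfl⟩)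

@[elab_as_elim]
theorem lideal_induction {p : (u : UEA L) → u ∈ lideal e m → Prop} (zero : p 0 (zero_mem _))
    (add : ∀ u v hu hv, p u hu → p v hv → p (u + v) (add_mem hu hv))
    (mul : ∀ (u : UEA L) (w : L) (hw : w ∈ m), p (u * shiftedι e w) (mul_shiftedι_mem u hw))
    {u : UEA L} (hu : u ∈ lideal e m) : p u hu := by
  induction hu using Submodule.closure_induction with
  | zero => exact zero
  | add u v hu' hv' hu hv => exact add u v hu' hv' hu hv
  | smul_mem r x h =>
    obtain ⟨w, hw, rfl⟩ := h
    exact mul r w hw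

theorem lideal_mono {m' : Submodule ℂ L} (h : m ≤ m') : lideal e m ≤ lideal e m' :=
  Submodule.span_mono (Set.image_mono h)

theorem adU_mem_lideal {z : L} (hz : ∀ w ∈ m, ⁅z, w⁆ ∈ m)
    (hχ : ∀ w ∈ m, killingForm ℂ L e ⁅z, w⁆ = 0) {u : UEA L} (hu : u ∈ lideal e m) :
    adU z u ∈ lideal e m := by
  induction hu using lideal_induction with
  | zero => simp
  | add u v _ _ hu hv => rw [map_add]; exact add_mem hu hv
  | mul u w hw =>
    rw [adU_mul, adU_shiftedι (hχ w hw)]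
    exact add_mem (mul_shiftedι_mem _ hw) (mul_shiftedι_mem _ (hz w hw))

theorem mul_shiftedι_mem_of_mem_lideal {y : L} (hy : ∀ w ∈ m, ⁅w, y⁆ ∈ m)
    (hχ : ∀ w ∈ m, killingForm ℂ L e ⁅w, y⁆ = 0) {u : UEA L} (hu : u ∈ lideal e m) :
    u * shiftedι e y ∈ lideal e m := by
  induction hu using lideal_induction with
  | zero => simp
  | add u v _ _ hu hv => rw [add_mul]; exact add_mem hu hv
  | mul u w hw =>
    rw [mul_assoc, shiftedι_mul, mul_add, ← mul_assoc, adU_shiftedι (hχ w hw)]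
    exact add_mem (mul_shiftedι_mem _ hw) (mul_shiftedι_mem _ (hy w hw))

theorem exists_sub_mul_shiftedι_mem {m' : Submodule ℂ L} {y : L}
    (hm : ∀ w ∈ m, ∃ c : ℂ, w - c • y ∈ m') {u : UEA L} (hu : u ∈ lideal e m) :
    ∃ v, u - v * shiftedι e y ∈ lideal e m' := by
  induction hu using lideal_induction with
  | zero => exact ⟨0, by simp⟩
  | add u v _ _ hu hv =>
    obtain ⟨a, ha⟩ := hu
    obtain ⟨b, hb⟩ := hv
    refine ⟨a + b, ?_⟩
    rw [add_mul, add_sub_add_comm]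
    exact add_mem ha hb
  | mul u w hw =>
    obtain ⟨c, hc⟩ := hm w hw
    refine ⟨c • u, ?_⟩
    rw [smul_mul_assoc, ← mul_smul_comm, ← mul_sub, ← shiftedι_sub_smul]
    exact mul_shiftedι_mem _ hc

theorem mem_invSet {u : UEA L} : u ∈ invSet e m n ↔ ∀ z ∈ n, adU z u ∈ lideal e m := by
  simp only [invSet, Submodule.mem_iInf, Submodule.mem_comap]
  rfl

theorem mul_mem_lideal_of_mem_invSet (hmn : m ≤ n) {u v : UEA L} (hu : u ∈ lideal e m)
    (hv : v ∈ invSet e m n) : u * v ∈ lideal e m := by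
  induction hu using lideal_induction with
  | zero => simp
  | add u v _ _ hu hv => rw [add_mul]; exact add_mem hu hv
  | mul u w hw =>
    rw [mul_assoc, shiftedι_mul, mul_add, ← mul_assoc]
    exact add_mem (mul_shiftedι_mem _ hw)
      (Submodule.smul_mem _ u (mem_invSet.mp hv w (hmn hw)))

theorem mul_mem_invSet (hmn : m ≤ n) {u v : UEA L} (hu : u ∈ invSet e m n)
    (hv : v ∈ invSet e m n) : u * v ∈ invSet e m n := by
  rw [mem_invSet]
  intro z hz
  rw [adU_mul]
  exact add_mem (mul_mem_lideal_of_mem_invSet hmn (mem_invSet.mp hu z hz) hv)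
    (Submodule.smul_mem _ u (mem_invSet.mp hv z hz))

theorem invSet_mono {m' n' : Submodule ℂ L} (hm : m ≤ m') (hn : n' ≤ n) :
    invSet e m n ≤ invSet e m' n' := fun _ hu =>
  mem_invSet.mpr fun z hz => lideal_mono hm (mem_invSet.mp hu z (hn hz))

end Ideal

/-! ### Isomorphism induced by an inclusion of pairs -/

/-- The natural map `H(𝔪, 𝔫) → H(𝔪', 𝔫')`, `u + I(𝔪) ↦ u + I(𝔪')`, is bijective. -/
structure NaturalMapBijective (e : L) (m n m' n' : Submodule ℂ L) : Prop where
  injective : ∀ u ∈ invSet e m n, u ∈ lideal e m' → u ∈ lideal e m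
  surjective : ∀ v ∈ invSet e m' n', ∃ u ∈ invSet e m n, u - v ∈ lideal e m'

section NaturalMap

variable {e : L} {m n m' n' : Submodule ℂ L}

theorem mk_eq_mk_lidealC {u v : UEA L} :
    (Submodule.Quotient.mk u : UEA L ⧸ lidealC e m) = Submodule.Quotient.mk v ↔
      u - v ∈ lideal e m :=
  Submodule.Quotient.eq _

theorem exists_rep_of_mem_Hsub (p : ↥(Hsub e m n)) :
    ∃ u ∈ invSet e m n, (p : UEA L ⧸ lidealC e m) = Submodule.Quotient.mk u := by
  obtain ⟨p, u, hu, rfl⟩ := p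
  exact ⟨u, hu, rfl⟩

/-- The natural map `H(𝔪, 𝔫) → H(𝔪', 𝔫')` for `𝔪 ⊆ 𝔪' ⊆ 𝔫' ⊆ 𝔫`. -/
def naturalMap (hm : m ≤ m') (hn : n' ≤ n) : ↥(Hsub e m n) →ₗ[ℂ] ↥(Hsub e m' n') :=
  (Submodule.factor (p := lidealC e m) (p' := lidealC e m') (lideal_mono hm)).restrict (by
    rintro _ ⟨u, hu, rfl⟩
    exact ⟨u, invSet_mono hm hn hu, rfl⟩)

theorem naturalMap_eq_mk (hm : m ≤ m') (hn : n' ≤ n) {p : ↥(Hsub e m n)} {u : UEA L}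
    (hp : (p : UEA L ⧸ lidealC e m) = Submodule.Quotient.mk u) :
    (naturalMap hm hn p : UEA L ⧸ lidealC e m') = Submodule.Quotient.mk u := by
  change Submodule.factor (p := lidealC e m) (p' := lidealC e m') (lideal_mono hm) p = _
  rw [hp]
  rfl

/-- The natural map as a linear equivalence. -/
def NaturalMapBijective.linearEquiv (h : NaturalMapBijective e m n m' n') (hm : m ≤ m')
    (hn : n' ≤ n) : ↥(Hsub e m n) ≃ₗ[ℂ] ↥(Hsub e m' n') :=
  LinearEquiv.ofBijective (naturalMap hm hn) ⟨by
    rw [injective_iff_map_eq_zero]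
    intro p hp
    obtain ⟨u, hu, hpu⟩ := exists_rep_of_mem_Hsub p
    have h0 := naturalMap_eq_mk hm hn hpu
    rw [hp, Submodule.coe_zero, eq_comm, Submodule.Quotient.mk_eq_zero] at h0
    apply Subtype.ext
    rw [hpu, Submodule.coe_zero, Submodule.Quotient.mk_eq_zero]
    exact h.injective u hu h0, by
    intro q
    obtain ⟨v, hv, hqv⟩ := exists_rep_of_mem_Hsub q
    obtain ⟨u, hu, huv⟩ := h.surjective v hv
    refine ⟨⟨Submodule.Quotient.mk u, u, hu, rfl⟩, Subtype.ext ?_⟩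
    rw [naturalMap_eq_mk hm hn rfl, hqv]
    exact mk_eq_mk_lidealC.mpr huv⟩

theorem NaturalMapBijective.wAlgebraIso (h : NaturalMapBijective e m n m' n') (hm : m ≤ m')
    (hn : n' ≤ n) : WAlgebraIso e m n m' n' := by
  refine ⟨h.linearEquiv hm hn, fun p hp => naturalMap_eq_mk hm hn hp, ?_⟩
  rintro p q r ⟨u, v, hu, hv, hp, hq, hr⟩
  exact ⟨u, v, invSet_mono hm hn hu, invSet_mono hm hn hv, naturalMap_eq_mk hm hn hp,
    naturalMap_eq_mk hm hn hq, naturalMap_eq_mk hm hn hr⟩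

theorem NaturalMapBijective.wAlgebraIso_symm (h : NaturalMapBijective e m n m' n') (hm : m ≤ m')
    (hmn : m ≤ n) (hmn' : m' ≤ n') (hn : n' ≤ n) : WAlgebraIso e m' n' m n := by
  have key : ∀ (p : ↥(Hsub e m' n')) (u : UEA L), u ∈ invSet e m n →
      (p : UEA L ⧸ lidealC e m') = Submodule.Quotient.mk u →
      ((h.linearEquiv hm hn).symm p : UEA L ⧸ lidealC e m) = Submodule.Quotient.mk u := by
    intro p u hu hp
    have : (h.linearEquiv hm hn).symm p = ⟨Submodule.Quotient.mk u, u, hu, rfl⟩ := by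
      rw [LinearEquiv.symm_apply_eq]
      apply Subtype.ext
      rw [hp]
      exact (naturalMap_eq_mk hm hn rfl).symm
    rw [this]
  refine ⟨(h.linearEquiv hm hn).symm, fun p hp => key p 1 ?_ hp, ?_⟩
  · rw [mem_invSet]
    intro z _
    rw [← map_one (algebraMap ℂ (UEA L)), adU_algebraMap]
    exact zero_mem _
  rintro p q r ⟨u, v, hu, hv, hp, hq, hr⟩
  obtain ⟨u', hu', huu'⟩ := h.surjective u hu
  obtain ⟨v', hv', hvv'⟩ := h.surjective v hv
  refine ⟨u', v', hu', hv', key p u' hu' ?_, key q v' hv' ?_,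
    key r _ (mul_mem_invSet hmn hu' hv') ?_⟩
  · rw [hp, eq_comm]
    exact mk_eq_mk_lidealC.mpr huu'
  · rw [hq, eq_comm]
    exact mk_eq_mk_lidealC.mpr hvv'
  · rw [hr, eq_comm]
    refine mk_eq_mk_lidealC.mpr ?_
    have h1 : u' * v' - u * v = u' * (v' - v) + (u' - u) * v := by noncomm_ring
    rw [h1]
    exact add_mem (Submodule.smul_mem _ u' hvv') (mul_mem_lideal_of_mem_invSet hmn' huu' hv)

theorem NaturalMapBijective.refl (e : L) (m n : Submodule ℂ L) :
    NaturalMapBijective e m n m n :=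
  ⟨fun _ _ h => h, fun v hv => ⟨v, hv, by simp⟩⟩

theorem NaturalMapBijective.trans {m'' n'' : Submodule ℂ L} (hm : m ≤ m') (hm' : m' ≤ m'')
    (hn : n' ≤ n) (h : NaturalMapBijective e m n m' n')
    (h' : NaturalMapBijective e m' n' m'' n'') : NaturalMapBijective e m n m'' n'' := by
  refine ⟨fun u hu hu' => h.injective u hu (h'.injective u (invSet_mono hm hn hu) hu'), ?_⟩
  intro v hv
  obtain ⟨w, hw, hwv⟩ := h'.surjective v hv
  obtain ⟨u, hu, huw⟩ := h.surjective w hw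
  refine ⟨u, hu, ?_⟩
  rw [← sub_add_sub_cancel u w v]
  exact add_mem (lideal_mono hm' huw) hwv

/-- One-dimensional steps: `𝔪 = 𝔪' ⊕ ℂ y` and `𝔫' = 𝔫 ⊕ ℂ x` with `χ([x, y]) = 1`. -/
theorem naturalMapBijective_of_codim_one {x y : L} (hm'm : m' ≤ m) (hmn : m ≤ n)
    (hx : ∀ w : L, ∃ k, (ad ℂ L x ^ k) w = 0) (hxn : ∀ z ∈ n, ⁅x, z⁆ ∈ n)
    (hn' : n' = n ⊔ Submodule.span ℂ {x})
    (hy : y ∈ m) (hm : ∀ w ∈ m, ∃ c : ℂ, w - c • y ∈ m')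
    (hxy : killingForm ℂ L e ⁅x, y⁆ = 1) (hxy' : ⁅x, y⁆ ∈ m')
    (hnm : ∀ z ∈ n, ∀ w ∈ m, ⁅z, w⁆ ∈ m) (hχ : ∀ z ∈ n, ∀ w ∈ m, killingForm ℂ L e ⁅z, w⁆ = 0)
    (hny : ∀ z ∈ n, ⁅z, y⁆ ∈ m')
    (hnm' : ∀ z ∈ n', ∀ w ∈ m', ⁅z, w⁆ ∈ m')
    (hχ' : ∀ z ∈ n', ∀ w ∈ m', killingForm ℂ L e ⁅z, w⁆ = 0) :
    NaturalMapBijective e m' n' m n := by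
  have hx' : x ∈ n' := hn' ▸ Submodule.mem_sup_right (Submodule.mem_span_singleton_self x)
  have hnn' : n ≤ n' := hn' ▸ le_sup_left
  have hD : lidealC e m' ≤ (lidealC e m').comap (adU x) := fun u hu =>
    adU_mem_lideal (hnm' x hx') (hχ' x hx') hu
  have hY : lidealC e m' ≤ (lidealC e m').comap (LinearMap.mulRight ℂ (shiftedι e y)) :=
    fun u hu => mul_shiftedι_mem_of_mem_lideal (fun w hw => hny w (hmn (hm'm hw)))
      (fun w hw => hχ w (hmn (hm'm hw)) y hy) hu
  have hDY : ∀ u, adU x (LinearMap.mulRight ℂ (shiftedι e y) u)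
      - LinearMap.mulRight ℂ (shiftedι e y) (adU x u) - u ∈ lidealC e m' := by
    intro u
    have h1 : adU x (LinearMap.mulRight ℂ (shiftedι e y) u)
      - LinearMap.mulRight ℂ (shiftedι e y) (adU x u) - u = u * shiftedι e ⁅x, y⁆ := by
      rw [LinearMap.mulRight_apply, LinearMap.mulRight_apply, adU_mul, shiftedι, shiftedι, map_sub,
        adU_ι, adU_algebraMap, hxy, map_one, sub_zero]
      noncomm_ring
    rw [h1]
    exact mul_shiftedι_mem u hxy'
  have hnil := adU_locally_nilpotent hx
  have hker : ∀ u, adU x u ∈ lideal e m' → u ∈ lideal e m → u ∈ lideal e m' := by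
    intro u hu hum
    obtain ⟨w, hw⟩ := exists_sub_mul_shiftedι_mem hm hum
    exact mem_of_commutator_sub_one_mem hD hY hDY hnil hu hw
  refine ⟨fun u hu hum => hker u (mem_invSet.mp hu x hx') hum, ?_⟩
  intro v hv
  obtain ⟨u, w, hu, huw⟩ := exists_mem_of_commutator_sub_one_mem hD hY hDY hnil v
  have huv : u - v ∈ lideal e m := by
    rw [← sub_add_cancel (u - v) (LinearMap.mulRight ℂ (shiftedι e y) w)]
    exact add_mem (lideal_mono hm'm huw) (mul_shiftedι_mem w hy)
  refine ⟨u, ?_, huv⟩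
  have hz : ∀ (k : ℕ), ∀ z ∈ n, (ad ℂ L x ^ k) z = 0 → adU z u ∈ lideal e m' := by
    intro k
    induction k with
    | zero =>
      intro z _ hz
      have hz' : z = 0 := by simpa using hz
      simp [hz', adU_apply]
    | succ k ih =>
      intro z hz hk
      apply hker
      · rw [← sub_add_cancel (adU x (adU z u)) (adU z (adU x u)), ← adU_lie]
        refine add_mem (ih _ (hxn z hz) ?_) (adU_mem_lideal (hnm' z (hnn' hz)) (hχ' z (hnn' hz)) hu)
        rwa [pow_succ] at hk
      · rw [← sub_add_cancel (adU z u) (adU z v), ← map_sub]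
        exact add_mem (adU_mem_lideal (hnm z hz) (hχ z hz) huv) (mem_invSet.mp hv z hz)
  rw [mem_invSet]
  intro z hzn'
  rw [hn', Submodule.mem_sup] at hzn'
  obtain ⟨z, hzn, x', hx', rfl⟩ := hzn'
  obtain ⟨c, rfl⟩ := Submodule.mem_span_singleton.mp hx'
  have h1 : adU (z + c • x) u = adU z u + c • adU x u := by
    simp only [adU_apply, map_add, map_smul, add_mul, mul_add, smul_mul_assoc,
      mul_smul_comm, smul_sub]
    abel
  rw [h1]
  obtain ⟨k, hk⟩ := hx z
  exact add_mem (hz k z hzn hk) ((lidealC e m').smul_mem c hu)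

end NaturalMap

/-! ### Gradings -/

/-- The skew-symmetric form `(x, y) ↦ χ([x, y])`. -/
def lieForm (e : L) : L →ₗ[ℂ] L →ₗ[ℂ] ℂ :=
  (ad ℂ L : L →ₗ[ℂ] Module.End ℂ L).compr₂ (killingForm ℂ L e)

section Grading

variable {g : ℤ → Submodule ℂ L} {e : L} {a : ℤ}

theorem le_of_graded {m W : Submodule ℂ L} (hm : m = ⨆ j : ℤ, g j ⊓ m)
    (h : ∀ j, g j ⊓ m ≤ W) : m ≤ W :=
  hm.le.trans (iSup_le h)

theorem IsZGrading.eq_zero_of_nonneg (hg : IsZGrading g) {n : Submodule ℂ L}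
    (hn : n ≤ ⨆ j < (0 : ℤ), g j) {k : ℤ} (hk : 0 ≤ k) {w : L} (hw : w ∈ g k) (hwn : w ∈ n) :
    w = 0 := by
  have h : (⨆ j < (0 : ℤ), g j) ≤ ⨆ j ≠ k, g j :=
    iSup₂_le fun j hj => le_iSup₂_of_le j (by omega) le_rfl
  exact (Submodule.disjoint_def.mp (hg.1.submodule_iSupIndep k)) w hw (h (hn hwn))

variable [FiniteDimensional ℂ L]

theorem IsZGrading.killingForm_eq_zero (hg : IsZGrading g) (he : e ∈ g a) {k : ℤ} {w : L}
    (hw : w ∈ g k) (hk : k ≠ -a) : killingForm ℂ L e w = 0 := by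
  rw [killingForm_apply_apply]
  refine LinearMap.trace_eq_zero_of_mapsTo_ne hg.1 (fun i => a + (k + i)) ?_ ?_
  · intro i
    omega
  · intro i z hz
    exact hg.2 _ _ _ he _ (hg.2 _ _ _ hw _ hz)

theorem IsZGrading.lieForm_eq_zero (hg : IsZGrading g) (he : e ∈ g a) {j k : ℤ} {x y : L}
    (hx : x ∈ g j) (hy : y ∈ g k) (hjk : j + k ≠ -a) : lieForm e x y = 0 :=
  hg.killingForm_eq_zero he (hg.2 _ _ _ hx _ hy) hjk

theorem IsZGrading.finite_ne_bot (hg : IsZGrading g) : {j | g j ≠ ⊥}.Finite :=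
  WellFoundedGT.finite_ne_bot_of_iSupIndep hg.1.submodule_iSupIndep

theorem IsZGrading.ad_locally_nilpotent (hg : IsZGrading g) {j : ℤ} (hj : j < 0) {x : L}
    (hx : x ∈ g j) (w : L) : ∃ k, (ad ℂ L x ^ k) w = 0 := by
  obtain ⟨N, hN⟩ := hg.finite_ne_bot.bddBelow
  have hpow : ∀ (k : ℕ) (i : ℤ), ∀ w ∈ g i, (ad ℂ L x ^ k) w ∈ g (k * j + i) := by
    intro k
    induction k with
    | zero => intro i w hw; simpa using hw
    | succ k ih =>
      intro i w hw
      rw [pow_succ, Module.End.mul_apply]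
      have h := ih _ _ (hg.2 _ _ _ hx _ hw)
      rwa [← add_assoc, ← add_one_mul, ← Nat.cast_succ] at h
  have hw : w ∈ ⨆ i, g i := by
    rw [hg.1.submodule_iSup_eq_top]
    trivial
  refine Submodule.iSup_induction g (motive := fun w => ∃ k, (ad ℂ L x ^ k) w = 0) hw
    (fun i w hw => ⟨(i - N + 1).toNat, ?_⟩) ⟨0, rfl⟩ ?_
  · have h := hpow (i - N + 1).toNat i w hw
    have hbot : g (((i - N + 1).toNat : ℤ) * j + i) = ⊥ := by
      by_contra hne
      have h1 : N ≤ _ := hN hne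
      have h2 : i - N + 1 ≤ ((i - N + 1).toNat : ℤ) := Int.self_le_toNat _
      nlinarith [Int.natCast_nonneg (i - N + 1).toNat]
    rw [hbot] at h
    exact h
  · rintro u v ⟨k, hk⟩ ⟨l, hl⟩
    refine ⟨k + l, ?_⟩
    rw [map_add, pow_add, Module.End.mul_apply _ _ v, hl, map_zero, add_zero, ← pow_add, add_comm,
      pow_add, Module.End.mul_apply, hk, map_zero]

end Grading

/-! ### Chains of pairs -/

/-- A pair `(𝔪, 𝔫)` squeezed in `(𝔪₁, 𝔫₁)`, with `𝔫` the orthogonal of `𝔪` in `𝔫₁` for the form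
`χ([x, y])`. -/
structure IsIntermediatePair (g : ℤ → Submodule ℂ L) (e : L) (m₁ n₁ m n : Submodule ℂ L) :
    Prop where
  le_left : m₁ ≤ m
  le : m ≤ n
  le_right : n ≤ n₁
  graded_left : m = ⨆ j : ℤ, g j ⊓ m
  graded_right : n = ⨆ j : ℤ, g j ⊓ n
  lie_mem : ∀ z ∈ n, ∀ w ∈ m, ⁅z, w⁆ ∈ m
  mem_iff : ∀ z ∈ n₁, z ∈ n ↔ ∀ w ∈ m, lieForm e z w = 0

section Chain

variable [FiniteDimensional ℂ L] {g : ℤ → Submodule ℂ L} {e : L} {a : ℤ}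
  {m₁ n₁ m n : Submodule ℂ L}

theorem IsIntermediatePair.exists_step (h : IsIntermediatePair g e m₁ n₁ m n)
    (hg : IsZGrading g) (he : e ∈ g a) (hgn₁ : n₁ = ⨆ j : ℤ, g j ⊓ n₁)
    (hm₁ : (⨆ j ≤ -a, g j) ≤ m₁) (hn₁ : n₁ ≤ ⨆ j < (0 : ℤ), g j)
    (hlie : ∀ x ∈ n₁, ∀ y ∈ n₁, ⁅x, y⁆ ∈ n₁) (hlie₁ : ∀ x ∈ n₁, ∀ y ∈ m₁, ⁅x, y⁆ ∈ m₁)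
    (horth : ∀ x ∈ n₁, ∀ y ∈ m₁, lieForm e x y = 0)
    (hrad : ∀ y ∈ m, (∀ x ∈ n₁, lieForm e x y = 0) → y ∈ m₁) (hne : n ≠ n₁) :
    ∃ m' n', IsIntermediatePair g e m₁ n₁ m' n' ∧ n < n' ∧ m' ≤ m ∧
      NaturalMapBijective e m' n' m n := by
  obtain ⟨j, hjS, hjmin⟩ := Set.exists_min_image {j | ¬ g j ⊓ n₁ ≤ n} id
    (hg.finite_ne_bot.subset fun j hj hbot => hj (by simp [hbot])) (by
      by_contra hS
      rw [Set.not_nonempty_iff_eq_empty, Set.eq_empty_iff_forall_notMem] at hS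
      exact hne (le_antisymm h.le_right (le_of_graded hgn₁ fun j => not_not.mp (hS j))))
  obtain ⟨x, ⟨hxj, hxn₁⟩, hxn⟩ := SetLike.not_le_iff_exists.mp hjS
  have hmin : ∀ k < j, ∀ w ∈ g k, w ∈ n₁ → w ∈ n := by
    intro k hk w hw hwn
    by_contra hwn'
    have h1 : j ≤ k := hjmin k fun hle => hwn' (hle ⟨hw, hwn⟩)
    omega
  have hneg : ∀ k, ∀ w ∈ g k, w ∈ n₁ → 0 ≤ k → w = 0 := fun k w hw hwn hk =>
    hg.eq_zero_of_nonneg hn₁ hk hw hwn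
  have hj : j < 0 := by
    by_contra hj
    exact hxn ((hneg j x hxj hxn₁ (by omega)) ▸ zero_mem n)
  have hlow : ∀ k ≤ -a, g k ≤ m₁ := fun k hk => (le_iSup₂_of_le k hk le_rfl).trans hm₁
  have horth' : ∀ z ∈ n, ∀ w ∈ m, lieForm e z w = 0 := fun z hz =>
    (h.mem_iff z (h.le_right hz)).mp hz
  obtain ⟨y, hym, hyj, hxy⟩ : ∃ y ∈ m, y ∈ g (-a - j) ∧ lieForm e x y = 1 := by
    by_contra hcon
    push Not at hcon
    refine hxn ((h.mem_iff x hxn₁).mpr ?_)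
    change m ≤ LinearMap.ker (lieForm e x)
    refine le_of_graded h.graded_left ?_
    rintro k y ⟨hyk, hym⟩
    rw [LinearMap.mem_ker]
    by_contra h0
    have hk : k = -a - j := by
      by_contra hk
      exact h0 (hg.lieForm_eq_zero he hxj hyk (by omega))
    subst hk
    refine hcon ((lieForm e x y)⁻¹ • y) (m.smul_mem _ hym) (Submodule.smul_mem _ _ hyk) ?_
    rw [map_smul, smul_eq_mul, inv_mul_cancel₀ h0]
  have hhigh : ∀ k > -a - j, ∀ w ∈ g k, w ∈ m → w ∈ m₁ := by
    intro k hk w hw hwm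
    refine hrad w hwm ?_
    change n₁ ≤ LinearMap.ker ((lieForm e).flip w)
    refine le_of_graded hgn₁ ?_
    rintro l z ⟨hzl, hzn⟩
    change lieForm e z w = 0
    by_cases hl : l < j
    · exact horth' z (hmin l hl z hzl hzn) w hwm
    · exact hg.lieForm_eq_zero he hzl hw (by omega)
  have hxz : ∀ z ∈ n, ⁅x, z⁆ ∈ n := by
    change n ≤ n.comap (ad ℂ L x)
    refine le_of_graded h.graded_right ?_
    rintro k z ⟨hzk, hzn⟩
    change ⁅x, z⁆ ∈ n
    by_cases hk : 0 ≤ k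
    · rw [hneg k z hzk (h.le_right hzn) hk, lie_zero]
      exact zero_mem n
    · exact hmin (j + k) (by omega) _ (hg.2 _ _ _ hxj _ hzk) (hlie x hxn₁ z (h.le_right hzn))
  set m' := m ⊓ LinearMap.ker (lieForm e x) with hm'
  have hm₁m' : m₁ ≤ m' := le_inf h.le_left fun w hw => horth x hxn₁ w hw
  have hm'm : m' ≤ m := inf_le_left
  have hsub : ∀ w ∈ m, w - lieForm e x w • y ∈ m' := fun w hw =>
    ⟨sub_mem hw (m.smul_mem _ hym), by
      change lieForm e x (w - lieForm e x w • y) = 0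
      rw [map_sub, map_smul, hxy, smul_eq_mul, mul_one, sub_self]⟩
  have hgm' : m' = ⨆ k : ℤ, g k ⊓ m' := by
    refine le_antisymm ?_ (iSup_le fun k => inf_le_right)
    have hle : m ≤ (⨆ k : ℤ, g k ⊓ m') ⊔ Submodule.span ℂ {y} := by
      refine le_of_graded h.graded_left ?_
      rintro k w ⟨hwk, hwm⟩
      by_cases hk : k = -a - j
      · subst hk
        rw [← sub_add_cancel w (lieForm e x w • y)]
        exact Submodule.add_mem_sup
          (Submodule.mem_iSup_of_mem _ ⟨sub_mem hwk (Submodule.smul_mem _ _ hyj), hsub w hwm⟩)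
          (Submodule.smul_mem _ _ (Submodule.mem_span_singleton_self y))
      · exact Submodule.mem_sup_left
          (Submodule.mem_iSup_of_mem k ⟨hwk, hwm, hg.lieForm_eq_zero he hxj hwk (by omega)⟩)
    intro w hw
    obtain ⟨s, hs, t, ht, rfl⟩ := Submodule.mem_sup.mp (hle (hm'm hw))
    obtain ⟨c, rfl⟩ := Submodule.mem_span_singleton.mp ht
    have hs' : lieForm e x s = 0 := ((iSup_le fun k => inf_le_right : _ ≤ m') hs).2
    have hw' : lieForm e x (s + c • y) = 0 := hw.2
    rw [map_add, map_smul, hs', hxy, zero_add, smul_eq_mul, mul_one] at hw'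
    rw [hw', zero_smul, add_zero]
    exact hs
  have hzw : ∀ z ∈ n, ∀ w ∈ m', ⁅z, w⁆ ∈ m' := by
    intro z hz
    change m' ≤ m'.comap (ad ℂ L z)
    refine le_of_graded hgm' ?_
    rintro k w ⟨hwk, hwm'⟩
    change ⁅z, w⁆ ∈ m'
    by_cases hk : k > -a - j
    · exact hm₁m' (hlie₁ z (h.le_right hz) w (hhigh k hk w hwk (hm'm hwm')))
    refine ⟨h.lie_mem z hz w (hm'm hwm'), ?_⟩
    have hle : n ≤ LinearMap.ker (lieForm e x ∘ₗ (ad ℂ L w : Module.End ℂ L)) := by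
      refine le_of_graded h.graded_right ?_
      rintro l z ⟨hzl, hzn⟩
      change lieForm e x ⁅w, z⁆ = 0
      by_cases hl : 0 ≤ l
      · rw [hneg l z hzl (h.le_right hzn) hl, lie_zero, map_zero]
      · exact hg.lieForm_eq_zero he hxj (hg.2 _ _ _ hwk _ hzl) (by omega)
    have h0 : lieForm e x ⁅w, z⁆ = 0 := hle hz
    change lieForm e x ⁅z, w⁆ = 0
    rw [← lie_skew, map_neg, h0, neg_zero]
  have hxw : ∀ w ∈ m', ⁅x, w⁆ ∈ m' := by
    change m' ≤ m'.comap (ad ℂ L x)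
    refine le_of_graded hgm' ?_
    rintro k w ⟨hwk, hwm'⟩
    change ⁅x, w⁆ ∈ m'
    by_cases hk : k > -a - j
    · exact hm₁m' (hlie₁ x hxn₁ w (hhigh k hk w hwk (hm'm hwm')))
    · exact hm₁m' (hlow (j + k) (by omega) (hg.2 _ _ _ hxj _ hwk))
  have hxy' : ⁅x, y⁆ ∈ m' := hm₁m' (hlow _ (by omega) (hg.2 _ _ _ hxj _ hyj))
  have hzy : ∀ z ∈ n, ⁅z, y⁆ ∈ m' := by
    have hle : n ≤ m'.comap (ad ℂ L y) := by
      refine le_of_graded h.graded_right ?_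
      rintro l z ⟨hzl, hzn⟩
      change ⁅y, z⁆ ∈ m'
      by_cases hl : 0 ≤ l
      · rw [hneg l z hzl (h.le_right hzn) hl, lie_zero]
        exact zero_mem m'
      · refine ⟨?_, hg.lieForm_eq_zero he hxj (hg.2 _ _ _ hyj _ hzl) (by omega)⟩
        rw [← lie_skew]
        exact neg_mem (h.lie_mem z hzn y hym)
    intro z hz
    rw [← lie_skew]
    exact neg_mem (hle hz)
  set n' := n ⊔ Submodule.span ℂ {x} with hn'
  have hnn' : n ≤ n' := le_sup_left
  have hxn' : x ∈ n' := Submodule.mem_sup_right (Submodule.mem_span_singleton_self x)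
  have hn'_le : ∀ {W : Submodule ℂ L}, n ≤ W → x ∈ W → n' ≤ W := fun h1 h2 =>
    sup_le h1 ((Submodule.span_singleton_le_iff_mem _ _).mpr h2)
  have hn'n₁ : n' ≤ n₁ := hn'_le h.le_right hxn₁
  have hlie' : ∀ z ∈ n', ∀ w ∈ m', ⁅z, w⁆ ∈ m' := by
    intro z hz w hw
    have hle : n' ≤ m'.comap (ad ℂ L w) := by
      refine hn'_le (fun z hz => ?_) ?_
      · change ⁅w, z⁆ ∈ m'
        rw [← lie_skew]
        exact neg_mem (hzw z hz w hw)
      · change ⁅w, x⁆ ∈ m'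
        rw [← lie_skew]
        exact neg_mem (hxw w hw)
    rw [← lie_skew]
    exact neg_mem (hle hz)
  have horth'' : ∀ z ∈ n', ∀ w ∈ m', lieForm e z w = 0 := by
    intro z hz w hw
    have hle : n' ≤ LinearMap.ker ((lieForm e).flip w) :=
      hn'_le (fun z hz => horth' z hz w (hm'm hw)) hw.2
    exact hle hz
  refine ⟨m', n', ⟨hm₁m', hm'm.trans (h.le.trans hnn'), hn'n₁, hgm', ?_, hlie', ?_⟩,
    lt_of_le_of_ne hnn' fun heq => hxn (heq ▸ hxn'), hm'm, ?_⟩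
  · refine le_antisymm (hn'_le ?_ ?_) (iSup_le fun k => inf_le_right)
    · exact le_of_graded h.graded_right fun k =>
        le_iSup_of_le k (inf_le_inf_left _ hnn')
    · exact Submodule.mem_iSup_of_mem j ⟨hxj, hxn'⟩
  · intro z hz
    refine ⟨horth'' z, fun hzm' => ?_⟩
    rw [← sub_add_cancel z (lieForm e z y • x)]
    refine Submodule.add_mem_sup ((h.mem_iff _ (sub_mem hz (n₁.smul_mem _ hxn₁))).mpr ?_)
      (Submodule.smul_mem _ _ (Submodule.mem_span_singleton_self x))
    intro w hw
    have h1 := hzm' _ (hsub w hw)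
    rw [map_sub, map_smul, smul_eq_mul] at h1
    rw [map_sub, map_smul, LinearMap.sub_apply, LinearMap.smul_apply, smul_eq_mul, mul_comm]
    exact h1
  · exact naturalMapBijective_of_codim_one hm'm h.le (hg.ad_locally_nilpotent hj hxj) hxz hn' hym
      (fun w hw => ⟨_, hsub w hw⟩) hxy hxy' h.lie_mem horth' hzy hlie' horth''

theorem IsIntermediatePair.naturalMapBijective (h : IsIntermediatePair g e m₁ n₁ m n)
    (hg : IsZGrading g) (he : e ∈ g a) (hgn₁ : n₁ = ⨆ j : ℤ, g j ⊓ n₁)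
    (hm₁ : (⨆ j ≤ -a, g j) ≤ m₁) (hn₁ : n₁ ≤ ⨆ j < (0 : ℤ), g j)
    (hlie : ∀ x ∈ n₁, ∀ y ∈ n₁, ⁅x, y⁆ ∈ n₁) (hlie₁ : ∀ x ∈ n₁, ∀ y ∈ m₁, ⁅x, y⁆ ∈ m₁)
    (horth : ∀ x ∈ n₁, ∀ y ∈ m₁, lieForm e x y = 0)
    (hrad : ∀ y ∈ m, (∀ x ∈ n₁, lieForm e x y = 0) → y ∈ m₁) :
    NaturalMapBijective e m₁ n₁ m n := by
  induction n using WellFoundedGT.induction generalizing m with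
  | ind n ih =>
    by_cases hne : n = n₁
    · subst hne
      obtain rfl : m = m₁ := le_antisymm
        (fun y hy => hrad y hy fun x hx => (h.mem_iff x hx).mp hx y hy) h.le_left
      exact NaturalMapBijective.refl e m n
    · obtain ⟨m', n', h', hnn', hm'm, hstep⟩ :=
        h.exists_step hg he hgn₁ hm₁ hn₁ hlie hlie₁ horth hrad hne
      exact NaturalMapBijective.trans h'.le_left hm'm h'.le_right
        (ih n' hnn' h' fun y hy => hrad y (hm'm hy)) hstep

/-- A dimension count: the pairing of `𝔫₁ / 𝔫` with `𝔪 / 𝔪₁` is perfect. -/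
theorem mem_of_lieForm_eq_zero (hm : m₁ ≤ m)
    (horth : ∀ x ∈ n₁, ∀ y ∈ m₁, lieForm e x y = 0)
    (hn : ∀ x ∈ n₁, (∀ y ∈ m, lieForm e x y = 0) → x ∈ n)
    (hdim : finrank ℂ ↥m₁ + finrank ℂ ↥n₁ = finrank ℂ ↥m + finrank ℂ ↥n)
    {y : L} (hy : y ∈ m) (hy0 : ∀ x ∈ n₁, lieForm e x y = 0) : y ∈ m₁ := by
  let f : ↥n₁ →ₗ[ℂ] Module.Dual ℂ ↥m := (lieForm e).domRestrict₁₂ n₁ m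
  have hf : ∀ (x : ↥n₁) (y : ↥m), f x y = lieForm e x y := fun _ _ => rfl
  have h1 := Subspace.finrank_add_finrank_dualCoannihilator_eq (LinearMap.range f)
  have h2 := LinearMap.finrank_range_add_finrank_ker f
  have h3 : finrank ℂ ↥(LinearMap.ker f) ≤ finrank ℂ ↥n := by
    rw [← Submodule.finrank_map_subtype_eq]
    refine Submodule.finrank_mono ?_
    rintro _ ⟨x, hx, rfl⟩
    exact hn x x.2 fun y hy => DFunLike.congr_fun (LinearMap.mem_ker.mp hx) (⟨y, hy⟩ : ↥m)
  have hmem : ∀ z : ↥m, z ∈ (LinearMap.range f).dualCoannihilator ↔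
      ∀ x ∈ n₁, lieForm e x z = 0 := by
    intro z
    rw [Submodule.mem_dualCoannihilator]
    constructor
    · intro h x hx
      exact h _ ⟨⟨x, hx⟩, rfl⟩
    · rintro h _ ⟨x, rfl⟩
      exact h x x.2
  have h4 : m₁.comap m.subtype = (LinearMap.range f).dualCoannihilator := by
    refine Submodule.eq_of_le_of_finrank_le ?_ ?_
    · intro z hz
      exact (hmem z).mpr fun x hx => horth x hx z hz
    · rw [(Submodule.comapSubtypeEquivOfLe hm).finrank_eq]
      omega
  exact h4.ge ((hmem ⟨y, hy⟩).mpr hy0)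

end Chain

/-! ### Admissible pairs -/

section Admissible

variable {g : ℤ → Submodule ℂ L} {e : L} {a : ℤ} {m n : Submodule ℂ L}

theorem mem_orthogonal_iff_lieForm (x : L) :
    ad ℂ L e x ∈ LinearMap.BilinForm.orthogonal (killingForm ℂ L) m ↔
      ∀ y ∈ m, lieForm e x y = 0 := by
  rw [LinearMap.BilinForm.mem_orthogonal_iff]
  refine forall₂_congr fun y _ => ?_
  change killingForm ℂ L y ⁅e, x⁆ = 0 ↔ killingForm ℂ L e ⁅x, y⁆ = 0
  rw [LieModule.traceForm_comm, LieModule.traceForm_apply_lie_apply]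

theorem IsAdmissiblePair.lieForm_eq_zero (h : IsAdmissiblePair g e a m n) {x y : L} (hx : x ∈ n)
    (hy : y ∈ m) : lieForm e x y = 0 := by
  obtain ⟨-, -, -, -, -, -, -, h3, -⟩ := h
  exact (mem_orthogonal_iff_lieForm x).mp (h3.ge (Submodule.mem_map_of_mem hx)).1 y hy

theorem IsAdmissiblePair.exists_sub_mem_ker (h : IsAdmissiblePair g e a m n) {x : L}
    (hx : ∀ y ∈ m, lieForm e x y = 0) : ∃ z ∈ n, x - z ∈ LinearMap.ker (ad ℂ L e) := by
  obtain ⟨-, -, -, -, -, -, -, h3, -⟩ := h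
  obtain ⟨z, hz, hzx⟩ := h3.le ⟨(mem_orthogonal_iff_lieForm x).mpr hx, LinearMap.mem_range_self _ x⟩
  exact ⟨z, hz, by rw [LinearMap.mem_ker, map_sub, hzx, sub_self]⟩

theorem IsAdmissiblePair.naturalMapBijective [FiniteDimensional ℂ L] {m₁ n₁ m₂ n₂ : Submodule ℂ L}
    (h₁ : IsAdmissiblePair g e a m₁ n₁) (h₂ : IsAdmissiblePair g e a m₂ n₂) (hg : IsZGrading g)
    (he : e ∈ g a) (hm : m₁ ≤ m₂) (hn : n₂ ≤ n₁) : NaturalMapBijective e m₁ n₁ m₂ n₂ := by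
  have horth : ∀ x ∈ n₁, ∀ y ∈ m₁, lieForm e x y = 0 := fun x hx y hy => h₁.lieForm_eq_zero hx hy
  have horth₂ : ∀ x ∈ n₂, ∀ y ∈ m₂, lieForm e x y = 0 :=
    fun x hx y hy => h₂.lieForm_eq_zero hx hy
  have hex := fun x => h₂.exists_sub_mem_ker (x := x)
  obtain ⟨-, hsub, -, hgn₁, hlow, -, hneg, -, hker, hlie, hdim₁⟩ := h₁
  obtain ⟨-, -, hgm₂, hgn₂, -, hmn, -, -, -, hlie₂, hdim₂⟩ := h₂
  have hmem : ∀ x ∈ n₁, (∀ y ∈ m₂, lieForm e x y = 0) → x ∈ n₂ := by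
    intro x hx hxm
    obtain ⟨z, hz, hxz⟩ := hex x hxm
    have h0 : x - z ∈ (⊥ : Submodule ℂ L) := hker.le ⟨sub_mem hx (hn hz), hxz⟩
    rw [Submodule.mem_bot, sub_eq_zero] at h0
    exact h0 ▸ hz
  have h : IsIntermediatePair g e m₁ n₁ m₂ n₂ :=
    ⟨hm, hmn, hn, hgm₂, hgn₂, hlie₂, fun x hx => ⟨horth₂ x, hmem x hx⟩⟩
  exact h.naturalMapBijective hg he hgn₁ hlow hneg hsub hlie horth fun y hy =>
    mem_of_lieForm_eq_zero hm horth hmem (hdim₁.trans hdim₂.symm) hy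

end Admissible

/-- **Proposition 4.6 (Sadaka).** If two `e`-admissible pairs `(𝔪₁, 𝔫₁)` and `(𝔪₂, 𝔫₂)`
are comparable, then the finite W-algebras `H(𝔪₁, 𝔫₁)` and `H(𝔪₂, 𝔫₂)` are isomorphic. -/
theorem stmt_11 {L : Type*} [LieRing L] [LieAlgebra ℂ L]
    [FiniteDimensional ℂ L] [LieAlgebra.IsSimple ℂ L]
    (e : L) (he : IsNilpotent (ad ℂ L e))
    (m₁ n₁ m₂ n₂ : Submodule ℂ L)
    (hcomp : ComparablePairs e (m₁, n₁) (m₂, n₂)) :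
    WAlgebraIso e m₁ n₁ m₂ n₂ := by
  obtain ⟨g, a, hg, -, hea, h₁, h₂, ⟨hm, hmn, hn⟩ | ⟨hm, hmn, hn⟩⟩ := hcomp
  · exact (h₁.naturalMapBijective h₂ hg hea hm hn).wAlgebraIso hm hn
  · exact (h₂.naturalMapBijective h₁ hg hea hm hn).wAlgebraIso_symm hm
      (hm.trans (hmn.trans hn)) hmn hn
end
end
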